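/- arXiv:1810.09346 — 3 statements merged into one kernel-verified Lean document; each statement's English description precedes it below -/
import Mathlib

section
/- Let K ≥ 2 and let T be an integer with T ≥ ln K. Let D be a distribution over [0,1]^K whose marginal in every coordinate is the uniform distribution U(0,1) (the coordinates need not be independent). Fix any binary loss vectors ℓ_{i,t} ∈ {0,1}. In the variable-noise full-information model driven by D, run the EW-Threshold algorithm with parameters η = ((ln K)/T)^{2/3} and θ = ((ln K)/T)^{1/3}. Then E[∑_{t=1}^T ∑_{i=1}^K q_{i,t}·ℓ_{i,t}] - min_{k ∈ {1,…,K}} ∑_{t=1}^T ℓ_{k,t} ≤ 3·T^{2/3}·(ln K)^{1/3}, where the expectation is over the noise parameters and the noise bits. -/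
open MeasureTheory

/-- Uniform measure on `[0,1]`. -/
noncomputable def uniform01 : Measure ℝ := volume.restrict (Set.Icc 0 1)

/-- Real value of a Boolean loss. -/
def b2r (b : Bool) : ℝ := if b then 1 else 0

open ProbabilityTheory

/-- Pathwise second-order regret bound for the exponential weights scheme. -/
lemma exponential_weights_regret {ι : Type*} [Fintype ι] [Nonempty ι] {T : ℕ} {η : ℝ} (hη : 0 < η)
    (l : ι → Fin T → ℝ) (hl : ∀ i t, |η * l i t| ≤ 1) (w : ι → ℕ → ℝ)
    (hw0 : ∀ i, w i 0 = 1)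
    (hw : ∀ i (t : Fin T), w i ((t : ℕ) + 1) = w i t * Real.exp (-η * l i t)) (k : ι) :
    (∑ t : Fin T, ∑ i, w i t / (∑ j, w j t) * l i t) - ∑ t, l k t
      ≤ Real.log (Fintype.card ι) / η
        + η * ∑ t : Fin T, ∑ i, w i t / (∑ j, w j t) * l i t ^ 2 := by
  have pos : ∀ n ≤ T, ∀ i, 0 < w i n := by
    intro n
    induction n with
    | zero => intro _ i; simp [hw0]
    | succ n ih =>
      intro h i
      have := hw i ⟨n, h⟩
      simp only at this
      rw [this]
      exact mul_pos (ih (by omega) i) (Real.exp_pos _)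
  have step : ∀ t : Fin T, ∑ i, w i ((t : ℕ) + 1) ≤ (∑ i, w i t) *
      Real.exp (-η * (∑ i, w i t / (∑ j, w j t) * l i t)
        + η ^ 2 * ∑ i, w i t / (∑ j, w j t) * l i t ^ 2) := by
    intro t
    have hW : 0 < ∑ j, w j t := Finset.sum_pos (fun i _ => pos t t.2.le i) Finset.univ_nonempty
    calc ∑ i, w i ((t : ℕ) + 1)
        ≤ ∑ i, w i t * (1 + (-η * l i t) + (η * l i t) ^ 2) := by
          refine Finset.sum_le_sum fun i _ => ?_
          rw [hw i t]
          refine mul_le_mul_of_nonneg_left ?_ (pos t t.2.le i).le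
          have h1 : |-η * l i t| ≤ 1 := by rw [neg_mul, abs_neg]; exact hl i t
          have := (abs_le.1 (Real.abs_exp_sub_one_sub_id_le h1)).2
          nlinarith
      _ = (∑ i, w i t) * (1 + (-η * (∑ i, w i t / (∑ j, w j t) * l i t)
        + η ^ 2 * ∑ i, w i t / (∑ j, w j t) * l i t ^ 2)) := by
          have h (f : ι → ℝ) : ∑ i, w i t / (∑ j, w j t) * f i
              = (∑ i, w i t * f i) / (∑ j, w j t) := by
            rw [Finset.sum_div]
            exact Finset.sum_congr rfl fun i _ => by ring
          rw [h, h (fun i => l i t ^ 2)]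
          have : ∑ i, w i t * (1 + (-η * l i t) + (η * l i t) ^ 2)
              = (∑ i, w i t) + (-η * ∑ i, w i t * l i t) + η ^ 2 * ∑ i, w i t * l i t ^ 2 := by
            rw [Finset.mul_sum, Finset.mul_sum, ← Finset.sum_add_distrib, ← Finset.sum_add_distrib]
            exact Finset.sum_congr rfl fun i _ => by ring
          rw [this]
          field_simp
          ring
      _ ≤ _ := by
          refine mul_le_mul_of_nonneg_left ?_ hW.le
          rw [add_comm]
          exact Real.add_one_le_exp _
  have upper : ∀ n (hn : n ≤ T), ∑ i, w i n ≤ Fintype.card ι * Real.exp (∑ t : Fin n,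
      (-η * (∑ i, w i t / (∑ j, w j t) * l i (Fin.castLE hn t))
        + η ^ 2 * ∑ i, w i t / (∑ j, w j t) * l i (Fin.castLE hn t) ^ 2)) := by
    intro n
    induction n with
    | zero => intro _; simp [hw0]
    | succ n ih =>
      intro h
      have h1 := step ⟨n, h⟩
      simp only at h1
      rw [Fin.sum_univ_castSucc, Real.exp_add, ← mul_assoc]
      refine h1.trans (mul_le_mul_of_nonneg_right (ih (by omega)) (Real.exp_pos _).le)
  have exact_w : ∀ n (hn : n ≤ T),
      w k n = Real.exp (∑ t : Fin n, -η * l k (Fin.castLE hn t)) := by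
    intro n
    induction n with
    | zero => intro _; simp [hw0]
    | succ n ih =>
      intro h
      have h1 := hw k ⟨n, h⟩
      simp only at h1
      rw [Fin.sum_univ_castSucc, Real.exp_add, h1, ih (by omega)]
      rfl
  have h1 := upper T le_rfl
  have h2 : w k T ≤ ∑ i, w i T :=
    Finset.single_le_sum (f := fun i => w i T) (fun i _ => (pos T le_rfl i).le) (Finset.mem_univ k)
  rw [exact_w T le_rfl] at h2
  have hc : (0 : ℝ) < Fintype.card ι := by exact_mod_cast Fintype.card_pos
  have h3 := Real.log_le_log (Real.exp_pos _) (h2.trans h1)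
  rw [Real.log_exp, Real.log_mul hc.ne' (Real.exp_pos _).ne', Real.log_exp,
    Finset.sum_add_distrib, ← Finset.mul_sum, ← Finset.mul_sum, ← Finset.mul_sum] at h3
  simp only [Fin.castLE_rfl, id] at h3
  rw [← sub_nonneg] at h3 ⊢
  have := div_nonneg h3 hη.le
  refine this.trans_eq ?_
  field_simp
  ring

/-- On a product space, a function that ignores one coordinate is uncorrelated with every function
of that coordinate. -/
lemma integral_mul_eval_pi {ι A : Type*} [Fintype ι] [DecidableEq ι] [MeasurableSpace A]
    [Nonempty A] (ρ : ι → Measure A) [∀ i, IsProbabilityMeasure (ρ i)] (t : ι)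
    {G : (ι → A) → ℝ} (hG : Measurable G) (hGt : ∀ x y, (∀ s, s ≠ t → x s = y s) → G x = G y)
    {F : A → ℝ} (hF : Measurable F) :
    ∫ x, G x * F (x t) ∂(Measure.pi ρ) = (∫ x, G x ∂(Measure.pi ρ)) * ∫ a, F a ∂(ρ t) := by
  have hind := (iIndepFun_pi (μ := ρ) (X := fun _ a => a) fun i => aemeasurable_id).indepFun_finset
    {t}ᶜ {t} disjoint_compl_left (fun i => measurable_pi_apply i)
  let e : ((({t}ᶜ : Finset ι) : Type _) → A) → ι → A :=
    fun y s => if h : s ∈ ({t}ᶜ : Finset ι) then y ⟨s, h⟩ else Classical.arbitrary A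
  have he : Measurable e := by
    refine measurable_pi_iff.2 fun s => ?_
    by_cases h : s ∈ ({t}ᶜ : Finset ι)
    · simpa only [e, h, dif_pos] using measurable_pi_apply _
    · simp only [e, h, dif_neg, not_false_eq_true, measurable_const]
  have hind2 := hind.comp (hG.comp he)
    (hF.comp (measurable_pi_apply (⟨t, Finset.mem_singleton_self t⟩ : ({t} : Finset ι))))
  have hGe : (G ∘ e) ∘ (fun (x : ι → A) (i : ({t}ᶜ : Finset ι)) => x i) = G := by
    funext x
    refine hGt _ _ fun s hs => ?_
    simp [e, hs]
  rw [hGe] at hind2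
  have hFt : Measurable fun x : ι → A => F (x t) := hF.comp (measurable_pi_apply t)
  rw [IndepFun.integral_fun_mul_eq_mul_integral (Y := fun x => F (x t)) hind2
    hG.aestronglyMeasurable hFt.aestronglyMeasurable]
  have hm := measurePreserving_eval ρ t
  rw [← hm.map_eq, integral_map hm.measurable.aemeasurable hF.aestronglyMeasurable]

/-- The two-block version of `integral_mul_eval_pi`. -/
lemma integral_mul_eval_prod_pi {ι A B : Type*} [Fintype ι] [DecidableEq ι] [MeasurableSpace A]
    [MeasurableSpace B] [Nonempty A] [Nonempty B] (μ : Measure A) (ν : Measure B)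
    [IsProbabilityMeasure μ] [IsProbabilityMeasure ν] (t : ι)
    {G : (ι → A) × (ι → B) → ℝ} (hG : Measurable G)
    (hGt : ∀ x y, (∀ s, s ≠ t → x.1 s = y.1 s ∧ x.2 s = y.2 s) → G x = G y)
    {F : A × B → ℝ} (hF : Measurable F) :
    ∫ x, G x * F (x.1 t, x.2 t) ∂((Measure.pi fun _ => μ).prod (Measure.pi fun _ => ν))
      = (∫ x, G x ∂((Measure.pi fun _ => μ).prod (Measure.pi fun _ => ν)))
        * ∫ a, F a ∂(μ.prod ν) := by
  have hm := measurePreserving_arrowProdEquivProdArrow A B ι (fun _ => μ) (fun _ => ν)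
  rw [← hm.integral_comp', ← hm.integral_comp' G]
  refine integral_mul_eval_pi (fun _ => μ.prod ν) t
    (hG.comp (MeasurableEquiv.arrowProdEquivProdArrow A B ι).measurable) ?_ hF
  intro x y h
  refine hGt _ _ fun s hs => ?_
  exact ⟨congrArg Prod.fst (h s hs), congrArg Prod.snd (h s hs)⟩

instance : IsProbabilityMeasure uniform01 := ⟨by simp [uniform01]⟩

/-- The thresholded loss estimate for true loss `b`, noise parameter `ε` and noise seed `u`. -/
noncomputable def lossEstimate (θ : ℝ) (b : Bool) (ε u : ℝ) : ℝ :=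
  (b2r (Bool.xor b (decide (u < (1 - ε) / 2))) - (1 - ε) / 2) / (1 - 2 * ((1 - ε) / 2)) *
    (if θ ≤ ε then 1 else 0)

lemma measurable_lossEstimate (θ : ℝ) (b : Bool) :
    Measurable fun z : ℝ × ℝ => lossEstimate θ b z.1 z.2 := by
  have h : Measurable fun z : ℝ × ℝ => b2r (Bool.xor b (decide (z.2 < (1 - z.1) / 2))) := by
    have : (fun z : ℝ × ℝ => b2r (Bool.xor b (decide (z.2 < (1 - z.1) / 2))))
        = fun z => if z.2 < (1 - z.1) / 2 then b2r (Bool.xor b true) else b2r (Bool.xor b false) := by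
      funext z
      split_ifs with h <;> simp [h]
    rw [this]
    exact Measurable.ite (measurableSet_lt (by fun_prop) (by fun_prop)) measurable_const
      measurable_const
  have h2 : Measurable fun z : ℝ × ℝ => if θ ≤ z.1 then (1 : ℝ) else 0 :=
    Measurable.ite (measurableSet_le (by fun_prop) (by fun_prop)) measurable_const measurable_const
  unfold lossEstimate
  fun_prop

lemma abs_lossEstimate_le {θ : ℝ} (hθ : 0 < θ) (hθ1 : θ ≤ 1) (b : Bool) (ε u : ℝ) :
    |lossEstimate θ b ε u| ≤ 1 / θ := by
  unfold lossEstimate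
  split_ifs with h
  · have hε : 0 < ε := hθ.trans_le h
    have hx : ∀ x : Bool, |b2r x - (1 - ε) / 2| ≤ (1 + ε) / 2 := by
      intro x
      cases x <;> simp only [b2r] <;> rw [abs_le] <;> constructor <;> norm_num <;> linarith
    rw [mul_one, abs_div, show 1 - 2 * ((1 - ε) / 2) = ε by ring, abs_of_pos hε,
      div_le_div_iff₀ hε hθ]
    nlinarith [hx (Bool.xor b (decide (u < (1 - ε) / 2)))]
  · simp [hθ.le]

lemma lossEstimate_sq_le {θ : ℝ} (hθ : 0 < θ) (b : Bool) {ε : ℝ} (hε1 : ε ≤ 1) (u : ℝ) :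
    lossEstimate θ b ε u ^ 2 ≤ if θ ≤ ε then ε ^ (-2 : ℤ) else 0 := by
  unfold lossEstimate
  split_ifs with h
  · have hε : 0 < ε := hθ.trans_le h
    have hx : ∀ x : Bool, |b2r x - (1 - ε) / 2| ≤ 1 := by
      intro x
      cases x <;> simp only [b2r] <;> rw [abs_le] <;> constructor <;> norm_num <;> linarith
    rw [mul_one, show 1 - 2 * ((1 - ε) / 2) = ε by ring, div_pow, zpow_neg, ← one_div]
    have := (sq_le_one_iff_abs_le_one _).2 (hx (Bool.xor b (decide (u < (1 - ε) / 2))))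
    exact div_le_div_of_nonneg_right this (by positivity)
  · simp

lemma integral_lossEstimate_seed {θ : ℝ} (hθ : 0 < θ) (b : Bool) {ε : ℝ} (hε1 : ε ≤ 1) :
    ∫ u, lossEstimate θ b ε u ∂uniform01 = if θ ≤ ε then b2r b else 0 := by
  by_cases h : θ ≤ ε
  swap
  · simp [lossEstimate, h]
  have hε : 0 < ε := hθ.trans_le h
  have hb : ∀ u, lossEstimate θ b ε u = (b2r b - (1 - ε) / 2) / ε
      + (1 - 2 * b2r b) / ε * (Set.Iio ((1 - ε) / 2)).indicator 1 u := by
    intro u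
    unfold lossEstimate
    rw [if_pos h, show 1 - 2 * ((1 - ε) / 2) = ε by ring, Set.indicator_apply]
    by_cases hu : u < (1 - ε) / 2 <;> cases b <;> simp [hu, b2r] <;> ring
  have hi : ∫ u, (Set.Iio ((1 - ε) / 2)).indicator (1 : ℝ → ℝ) u ∂uniform01 = (1 - ε) / 2 := by
    rw [integral_indicator_one measurableSet_Iio, uniform01, measureReal_restrict_apply
      measurableSet_Iio]
    have : Set.Iio ((1 - ε) / 2) ∩ Set.Icc 0 1 = Set.Ico 0 ((1 - ε) / 2) := by
      ext u
      simp only [Set.mem_inter_iff, Set.mem_Iio, Set.mem_Icc, Set.mem_Ico]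
      constructor
      · rintro ⟨h1, h2, h3⟩; exact ⟨h2, h1⟩
      · rintro ⟨h1, h2⟩; exact ⟨h2, h1, by linarith⟩
    rw [this, Real.volume_real_Ico_of_le (by linarith), sub_zero]
  simp_rw [hb]
  rw [integral_add (integrable_const _)
    (((show Integrable (1 : ℝ → ℝ) uniform01 from integrable_const 1).indicator measurableSet_Iio).const_mul _), integral_const_mul, hi,
    if_pos h]
  simp
  field_simp
  ring

lemma integrable_lossEstimate {θ : ℝ} (hθ : 0 < θ) (hθ1 : θ ≤ 1) (b : Bool) :
    Integrable (fun z : ℝ × ℝ => lossEstimate θ b z.1 z.2) (uniform01.prod uniform01) :=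
  .of_bound (measurable_lossEstimate θ b).aestronglyMeasurable (1 / θ)
    (.of_forall fun _ => abs_lossEstimate_le hθ hθ1 _ _ _)

lemma Ici_inter_Icc_zero_one {θ : ℝ} (hθ : 0 ≤ θ) : Set.Ici θ ∩ Set.Icc 0 1 = Set.Icc θ 1 := by
  ext u
  simp only [Set.mem_inter_iff, Set.mem_Ici, Set.mem_Icc]
  constructor
  · rintro ⟨h1, h2, h3⟩; exact ⟨h1, h3⟩
  · rintro ⟨h1, h2⟩; exact ⟨h1, by linarith, h2⟩

lemma integral_lossEstimate {θ : ℝ} (hθ : 0 < θ) (hθ1 : θ ≤ 1) (b : Bool) :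
    ∫ z, lossEstimate θ b z.1 z.2 ∂(uniform01.prod uniform01) = (1 - θ) * b2r b := by
  rw [integral_prod _ (integrable_lossEstimate hθ hθ1 b)]
  have h1 : ∀ᵐ ε ∂uniform01, ∫ u, lossEstimate θ b ε u ∂uniform01
      = (Set.Ici θ).indicator (fun _ => b2r b) ε := by
    refine ae_restrict_of_forall_mem measurableSet_Icc fun ε hε => ?_
    rw [integral_lossEstimate_seed hθ b hε.2]
    simp [Set.indicator_apply]
  rw [integral_congr_ae h1, integral_indicator_const _ measurableSet_Ici, uniform01,
    measureReal_restrict_apply measurableSet_Ici]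
  rw [Ici_inter_Icc_zero_one hθ.le, Real.volume_real_Icc_of_le hθ1, smul_eq_mul]

lemma integral_lossEstimate_sq_le {θ : ℝ} (hθ : 0 < θ) (hθ1 : θ ≤ 1) (b : Bool) :
    ∫ z, lossEstimate θ b z.1 z.2 ^ 2 ∂(uniform01.prod uniform01) ≤ 1 / θ := by
  have hint : Integrable (fun z : ℝ × ℝ => lossEstimate θ b z.1 z.2 ^ 2)
      (uniform01.prod uniform01) := by
    refine .of_bound ((measurable_lossEstimate θ b).pow_const 2).aestronglyMeasurable ((1 / θ) ^ 2)
      (.of_forall fun z => ?_)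
    rw [Real.norm_eq_abs, abs_pow]
    exact pow_le_pow_left₀ (abs_nonneg _) (abs_lossEstimate_le hθ hθ1 _ _ _) 2
  rw [integral_prod _ hint]
  have hcont : ContinuousOn (fun ε : ℝ => ε ^ (-2 : ℤ)) (Set.Icc θ 1) := fun ε hε =>
    (continuousAt_zpow₀ ε (-2) (Or.inl (hθ.trans_le hε.1).ne')).continuousWithinAt
  have hset := Ici_inter_Icc_zero_one hθ.le
  have hind : Integrable ((Set.Ici θ).indicator fun ε : ℝ => ε ^ (-2 : ℤ)) uniform01 := by
    rw [integrable_indicator_iff measurableSet_Ici, uniform01, IntegrableOn,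
      Measure.restrict_restrict measurableSet_Ici, hset]
    exact hcont.integrableOn_Icc
  have h1 : ∀ᵐ ε ∂uniform01, ∫ u, lossEstimate θ b ε u ^ 2 ∂uniform01
      ≤ (Set.Ici θ).indicator (fun ε : ℝ => ε ^ (-2 : ℤ)) ε := by
    refine ae_restrict_of_forall_mem measurableSet_Icc fun ε hε => ?_
    refine (integral_mono_of_nonneg (.of_forall fun u => sq_nonneg _) (integrable_const _)
      (.of_forall fun u => lossEstimate_sq_le hθ b hε.2 u)).trans_eq ?_
    simp [Set.indicator_apply]
  refine (integral_mono_ae hint.integral_prod_left hind h1).trans ?_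
  rw [integral_indicator measurableSet_Ici, uniform01,
    Measure.restrict_restrict measurableSet_Ici, hset, integral_Icc_eq_integral_Ioc,
    ← intervalIntegral.integral_of_le hθ1, integral_zpow (Or.inr ⟨by norm_num, ?_⟩)]
  · norm_num [zpow_neg]
    rw [div_neg, div_one]
    linarith
  · rw [Set.uIcc_of_le hθ1]
    exact fun h => absurd h.1 (not_le.2 hθ)

set_option maxHeartbeats 1000000 in
/-- EW-Threshold in the Full Information with Variable Noise model with
uniform marginals.  Sample space: `ω.1 t` is the noise vector `(ε_{1,t},…,ε_{K,t})` drawn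
from `D` (independently across rounds); `ω.2 t i` is a uniform seed, so
`decide (ω.2 t i < (1 - ω.1 t i)/2)` is, conditionally on the noise parameters, a
Bernoulli(p_{i,t}) bit, independent across actions and rounds. -/
theorem ew_threshold_uniform (K T : ℕ) (hK : 2 ≤ K) (hT : Real.log K ≤ (T : ℝ))
    (D : Measure (Fin K → ℝ)) (hDprob : IsProbabilityMeasure D)
    (hDmarg : ∀ i : Fin K, D.map (fun v => v i) = uniform01)
    (η θ : ℝ)
    (hη : η = (Real.log K / T) ^ ((2 : ℝ) / 3))
    (hθ : θ = (Real.log K / T) ^ ((1 : ℝ) / 3))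
    (ℓ : Fin K → Fin T → Bool)
    (c : Fin K → Fin T → ((Fin T → Fin K → ℝ) × (Fin T → Fin K → ℝ)) → Bool)
    (hc : ∀ i t ω, c i t ω = Bool.xor (ℓ i t) (decide (ω.2 t i < (1 - ω.1 t i) / 2)))
    (lhat : ((Fin T → Fin K → ℝ) × (Fin T → Fin K → ℝ)) → Fin K → Fin T → ℝ)
    (hlhat : ∀ ω i t, lhat ω i t =
      (b2r (c i t ω) - (1 - ω.1 t i) / 2) / (1 - 2 * ((1 - ω.1 t i) / 2)) *
        (if θ ≤ ω.1 t i then 1 else 0))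
    (w : ((Fin T → Fin K → ℝ) × (Fin T → Fin K → ℝ)) → Fin K → ℕ → ℝ)
    (q : ((Fin T → Fin K → ℝ) × (Fin T → Fin K → ℝ)) → Fin K → Fin T → ℝ)
    (hw0 : ∀ ω i, w ω i 0 = 1)
    (hw : ∀ ω i (t : Fin T), w ω i ((t : ℕ) + 1) = w ω i t * Real.exp (-η * lhat ω i t))
    (hq : ∀ ω i t, q ω i t = w ω i t / ∑ j, w ω j t) :
    (∫ ω, (∑ t, ∑ i, q ω i t * b2r (ℓ i t))
        ∂((Measure.pi fun _ : Fin T => D).prod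
            (Measure.pi fun _ : Fin T => Measure.pi fun _ : Fin K => uniform01)))
      - Finset.univ.inf' (Finset.univ_nonempty_iff.mpr ⟨⟨0, by omega⟩⟩)
          (fun k => ∑ t, b2r (ℓ k t))
      ≤ 3 * (T : ℝ) ^ ((2 : ℝ) / 3) * Real.log K ^ ((1 : ℝ) / 3) := by
  have : Nonempty (Fin K) := ⟨⟨0, by omega⟩⟩
  have hL : 0 < Real.log K := Real.log_pos (by exact_mod_cast hK)
  have hT0 : (0 : ℝ) < T := hL.trans_le hT
  have hr : 0 < Real.log K / T := div_pos hL hT0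
  have hθ0 : 0 < θ := hθ ▸ Real.rpow_pos_of_pos hr _
  have hη0 : 0 < η := hη ▸ Real.rpow_pos_of_pos hr _
  have hθ1 : θ ≤ 1 := hθ ▸ Real.rpow_le_one hr.le ((div_le_one hT0).2 hT) (by norm_num)
  have hηθ : η = θ ^ 2 := by
    rw [hη, hθ, ← Real.rpow_natCast, ← Real.rpow_mul hr.le]
    norm_num
  have hθ3 : Real.log K = θ ^ 3 * T := by
    rw [hθ, ← Real.rpow_natCast, ← Real.rpow_mul hr.le]
    norm_num
    field_simp
  have hbound : (T : ℝ) ^ ((2 : ℝ) / 3) * Real.log K ^ ((1 : ℝ) / 3) = θ * T := by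
    rw [hθ, Real.div_rpow hL.le hT0.le, show (2 : ℝ) / 3 = 1 - 1 / 3 by norm_num,
      Real.rpow_sub hT0, Real.rpow_one]
    ring
  have hest : ∀ ω i t, lhat ω i t = lossEstimate θ (ℓ i t) (ω.1 t i) (ω.2 t i) := by
    intro ω i t
    rw [hlhat, hc]
    rfl
  have hlm : ∀ i t, Measurable fun ω => lhat ω i t := by
    intro i t
    simp_rw [hest]
    exact (measurable_lossEstimate θ (ℓ i t)).comp
      (by fun_prop : Measurable fun ω : (Fin T → Fin K → ℝ) × (Fin T → Fin K → ℝ) =>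
        (ω.1 t i, ω.2 t i))
  have hlb : ∀ ω i t, |lhat ω i t| ≤ 1 / θ := fun ω i t => by
    rw [hest]; exact abs_lossEstimate_le hθ0 hθ1 _ _ _
  have hηl : ∀ ω i t, |η * lhat ω i t| ≤ 1 := by
    intro ω i t
    rw [abs_mul, abs_of_pos hη0]
    calc η * |lhat ω i t| ≤ θ ^ 2 * (1 / θ) := by
          rw [hηθ]; exact mul_le_mul_of_nonneg_left (hlb ω i t) (sq_nonneg θ)
      _ = θ := by field_simp
      _ ≤ 1 := hθ1
  have hwprop : ∀ n ≤ T, (∀ ω i, 0 < w ω i n) ∧ (∀ i, Measurable fun ω => w ω i n) ∧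
      ∀ t : Fin T, n ≤ t → ∀ x y, (∀ s, s ≠ t → x.1 s = y.1 s ∧ x.2 s = y.2 s) →
        ∀ i, w x i n = w y i n := by
    intro n
    induction n with
    | zero =>
      intro _
      simp only [hw0]
      exact ⟨fun _ _ => one_pos, fun _ => measurable_const, by simp⟩
    | succ n ih =>
      intro hn
      obtain ⟨h1, h2, h3⟩ := ih (by omega)
      have hs : ∀ ω i, w ω i (n + 1) = w ω i n * Real.exp (-η * lhat ω i ⟨n, hn⟩) :=
        fun ω i => hw ω i ⟨n, hn⟩
      simp only [hs]
      refine ⟨fun ω i => mul_pos (h1 ω i) (Real.exp_pos _),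
        fun i => (h2 i).mul ((hlm i _).const_mul _).exp, fun t ht x y hxy i => ?_⟩
      have hne : (⟨n, hn⟩ : Fin T) ≠ t := by
        rintro rfl
        simp at ht
      rw [h3 t (by omega) x y hxy i, hest, hest, (hxy _ hne).1, (hxy _ hne).2]
  have hqm : ∀ i t, Measurable fun ω => q ω i t := by
    intro i t
    simp_rw [hq]
    exact ((hwprop t t.2.le).2.1 i).div
      (Finset.measurable_sum _ fun j _ => (hwprop t t.2.le).2.1 j)
  have hqt : ∀ (i) (t : Fin T) x y, (∀ s, s ≠ t → x.1 s = y.1 s ∧ x.2 s = y.2 s) →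
      q x i t = q y i t := by
    intro i t x y hxy
    rw [hq, hq]
    simp_rw [(hwprop t t.2.le).2.2 t le_rfl x y hxy]
  have hq0 : ∀ ω i t, 0 ≤ q ω i t := fun ω i t => by
    rw [hq]
    exact div_nonneg ((hwprop t t.2.le).1 ω i).le
      (Finset.sum_nonneg fun j _ => ((hwprop t t.2.le).1 ω j).le)
  have hqs : ∀ ω t, ∑ i, q ω i t = 1 := fun ω t => by
    simp_rw [hq]
    rw [← Finset.sum_div]
    exact div_self (Finset.sum_pos (fun j _ => (hwprop t t.2.le).1 ω j) Finset.univ_nonempty).ne'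
  have hq1 : ∀ ω i t, |q ω i t| ≤ 1 := fun ω i t => by
    rw [abs_of_nonneg (hq0 ω i t), ← hqs ω t]
    exact Finset.single_le_sum (f := fun i => q ω i t) (fun j _ => hq0 ω j t) (Finset.mem_univ i)
  set μ := (Measure.pi fun _ : Fin T => D).prod
    (Measure.pi fun _ : Fin T => Measure.pi fun _ : Fin K => uniform01) with hμ
  have hmarg : ∀ i : Fin K, MeasurePreserving (Prod.map (fun v : Fin K → ℝ => v i)
      (fun v : Fin K → ℝ => v i)) (D.prod (Measure.pi fun _ : Fin K => uniform01))
      (uniform01.prod uniform01) := fun i =>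
    MeasurePreserving.prod ⟨measurable_pi_apply i, hDmarg i⟩
      (measurePreserving_eval (fun _ : Fin K => uniform01) i)
  have hround : ∀ (i t) (G : (Fin T → Fin K → ℝ) × (Fin T → Fin K → ℝ) → ℝ), Measurable G →
      (∀ x y, (∀ s, s ≠ t → x.1 s = y.1 s ∧ x.2 s = y.2 s) → G x = G y) →
      ∀ F : ℝ × ℝ → ℝ, Measurable F → ∫ ω, G ω * F (ω.1 t i, ω.2 t i) ∂μ
        = (∫ ω, G ω ∂μ) * ∫ z, F z ∂(uniform01.prod uniform01) := by
    intro i t G hG hGt F hF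
    have h := integral_mul_eval_prod_pi D (Measure.pi fun _ : Fin K => uniform01) t hG hGt
      (F := F ∘ Prod.map (fun v : Fin K → ℝ => v i) (fun v : Fin K → ℝ => v i))
      (hF.comp (hmarg i).measurable)
    rw [← (hmarg i).map_eq, integral_map (hmarg i).measurable.aemeasurable hF.aestronglyMeasurable]
    exact h
  have hqi : ∀ i t, Integrable (fun ω => q ω i t) μ := fun i t =>
    .of_bound (hqm i t).aestronglyMeasurable 1 (.of_forall fun ω => hq1 ω i t)
  have hli : ∀ i t, Integrable (fun ω => lhat ω i t) μ := fun i t =>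
    .of_bound (hlm i t).aestronglyMeasurable (1 / θ) (.of_forall fun ω => hlb ω i t)
  have hqli : ∀ i t, Integrable (fun ω => q ω i t * lhat ω i t) μ := fun i t =>
    (hli i t).bdd_mul (c := 1) (hqm i t).aestronglyMeasurable (.of_forall fun ω => hq1 ω i t)
  have hqli2 : ∀ i t, Integrable (fun ω => q ω i t * lhat ω i t ^ 2) μ := fun i t => by
    have := (hqli i t).mul_bdd (c := 1 / θ) (hlm i t).aestronglyMeasurable
      (.of_forall fun ω => hlb ω i t)
    refine this.congr (.of_forall fun ω => ?_)
    simp only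
    ring
  have hEl : ∀ i t, ∫ ω, lhat ω i t ∂μ = (1 - θ) * b2r (ℓ i t) := by
    intro i t
    have := hround i t (fun _ => 1) measurable_const (fun _ _ _ => rfl) _
      (measurable_lossEstimate θ (ℓ i t))
    simp only [integral_lossEstimate hθ0 hθ1] at this
    simpa [hest] using this
  have hEql : ∀ i t, ∫ ω, q ω i t * lhat ω i t ∂μ
      = (∫ ω, q ω i t ∂μ) * ((1 - θ) * b2r (ℓ i t)) := by
    intro i t
    have := hround i t (fun ω => q ω i t) (hqm i t) (hqt i t) _ (measurable_lossEstimate θ (ℓ i t))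
    simp only [integral_lossEstimate hθ0 hθ1] at this
    simpa [hest] using this
  have hEql2 : ∀ i t, ∫ ω, q ω i t * lhat ω i t ^ 2 ∂μ ≤ (∫ ω, q ω i t ∂μ) * (1 / θ) := by
    intro i t
    have := hround i t (fun ω => q ω i t) (hqm i t) (hqt i t) _
      ((measurable_lossEstimate θ (ℓ i t)).pow_const 2)
    simp only [hest]
    rw [this]
    exact mul_le_mul_of_nonneg_left (integral_lossEstimate_sq_le hθ0 hθ1 _)
      (integral_nonneg fun ω => hq0 ω i t)
  have hEqs : ∀ t, ∑ i, ∫ ω, q ω i t ∂μ = 1 := fun t => by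
    rw [← integral_finsetSum _ fun i _ => hqi i t]
    simp [hqs]
  have hEq0 : ∀ i t, 0 ≤ ∫ ω, q ω i t ∂μ := fun i t => integral_nonneg fun ω => hq0 ω i t
  have hA : ∫ ω, (∑ t, ∑ i, q ω i t * b2r (ℓ i t)) ∂μ
      = ∑ t, ∑ i, (∫ ω, q ω i t ∂μ) * b2r (ℓ i t) := by
    rw [integral_finsetSum _ fun t _ => integrable_finsetSum _ fun i _ => (hqi i t).mul_const _]
    refine Finset.sum_congr rfl fun t _ => ?_
    rw [integral_finsetSum _ fun i _ => (hqi i t).mul_const _]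
    exact Finset.sum_congr rfl fun i _ => integral_mul_const _ _
  obtain ⟨k, -, hk⟩ := Finset.exists_mem_eq_inf' (Finset.univ_nonempty (α := Fin K))
    (fun k => ∑ t, b2r (ℓ k t))
  rw [hk, hA]
  have hb0 : ∀ b, 0 ≤ b2r b := fun b => by cases b <;> simp [b2r]
  have hb1 : ∀ b, b2r b ≤ 1 := fun b => by cases b <;> simp [b2r]
  have hAT : ∑ t, ∑ i, (∫ ω, q ω i t ∂μ) * b2r (ℓ i t) ≤ T := by
    calc ∑ t, ∑ i, (∫ ω, q ω i t ∂μ) * b2r (ℓ i t) ≤ ∑ t : Fin T, ∑ i, ∫ ω, q ω i t ∂μ :=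
          Finset.sum_le_sum fun t _ => Finset.sum_le_sum fun i _ =>
            mul_le_of_le_one_right (hEq0 i t) (hb1 _)
      _ = T := by simp [hEqs]
  have hLk : 0 ≤ ∑ t, b2r (ℓ k t) := Finset.sum_nonneg fun t _ => hb0 _
  have hI1 : Integrable (fun ω => ∑ t, ∑ i, q ω i t * lhat ω i t) μ :=
    integrable_finsetSum _ fun t _ => integrable_finsetSum _ fun i _ => hqli i t
  have hI2 : Integrable (fun ω => ∑ t, lhat ω k t) μ := integrable_finsetSum _ fun t _ => hli k t
  have hI3 : Integrable (fun ω => ∑ t, ∑ i, q ω i t * lhat ω i t ^ 2) μ :=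
    integrable_finsetSum _ fun t _ => integrable_finsetSum _ fun i _ => hqli2 i t
  have hpath : ∀ ω, (∑ t, ∑ i, q ω i t * lhat ω i t) - ∑ t, lhat ω k t
      ≤ Real.log K / η + η * ∑ t, ∑ i, q ω i t * lhat ω i t ^ 2 := by
    intro ω
    have := exponential_weights_regret hη0 (lhat ω) (hηl ω) (w ω) (hw0 ω) (hw ω) k
    simpa only [hq, Fintype.card_fin] using this
  have hmain := integral_mono (hI1.sub hI2) ((integrable_const (Real.log K / η)).add
    (hI3.const_mul η)) hpath
  have e1 : ∫ ω, ∑ t, ∑ i, q ω i t * lhat ω i t ∂μ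
      = (1 - θ) * ∑ t, ∑ i, (∫ ω, q ω i t ∂μ) * b2r (ℓ i t) := by
    rw [integral_finsetSum _ fun t _ => integrable_finsetSum _ fun i _ => hqli i t, Finset.mul_sum]
    refine Finset.sum_congr rfl fun t _ => ?_
    rw [integral_finsetSum _ fun i _ => hqli i t, Finset.mul_sum]
    refine Finset.sum_congr rfl fun i _ => ?_
    rw [hEql]
    ring
  have e2 : ∫ ω, ∑ t, lhat ω k t ∂μ = (1 - θ) * ∑ t, b2r (ℓ k t) := by
    rw [integral_finsetSum _ fun t _ => hli k t, Finset.mul_sum]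
    exact Finset.sum_congr rfl fun t _ => hEl k t
  have e3 : ∫ ω, ∑ t, ∑ i, q ω i t * lhat ω i t ^ 2 ∂μ ≤ T * (1 / θ) := by
    rw [integral_finsetSum _ fun t _ => integrable_finsetSum _ fun i _ => hqli2 i t]
    calc _ ≤ ∑ _t : Fin T, 1 / θ := by
          refine Finset.sum_le_sum fun t _ => ?_
          rw [integral_finsetSum _ fun i _ => hqli2 i t]
          refine (Finset.sum_le_sum fun i _ => hEql2 i t).trans_eq ?_
          rw [← Finset.sum_mul, hEqs, one_mul]
      _ = T * (1 / θ) := by simp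
  have hmain2 : (∫ ω, ∑ t, ∑ i, q ω i t * lhat ω i t ∂μ) - ∫ ω, ∑ t, lhat ω k t ∂μ
      ≤ Real.log K / η + η * ∫ ω, ∑ t, ∑ i, q ω i t * lhat ω i t ^ 2 ∂μ := by
    rw [← integral_sub hI1 hI2, ← integral_const_mul]
    refine hmain.trans_eq ?_
    simp only [Pi.add_apply]
    rw [integral_add (integrable_const _) (hI3.const_mul η)]
    simp
  rw [e1, e2] at hmain2
  have f1 : Real.log K / η = θ * T := by
    rw [hθ3, hηθ]
    field_simp
  have f2 : η * (T * (1 / θ)) = θ * T := by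
    rw [hηθ]
    field_simp
  have f3 := mul_le_mul_of_nonneg_left e3 hη0.le
  rw [mul_assoc, hbound]
  have f4 := mul_le_mul_of_nonneg_left
    (show ∑ t, ∑ i, (∫ ω, q ω i t ∂μ) * b2r (ℓ i t) - ∑ t, b2r (ℓ k t) ≤ T by linarith) hθ0.le
  linarith
end

section
/- There exists a universal constant c > 0 with the following property. Let K be an integer with ln K ≥ 18 and let T be an integer large enough that T^{2/3}·(ln K)^{1/3} ≥ 2·ln K. Consider the variable-noise full-information model with the noise distribution D' under which at each round a single value ε_t ~ U(0,1) is drawn and ε_{i,t} = ε_t for every action i. Then for every full-information learning algorithm (which observes the realized noise parameters before acting and observes the noisy feedback of every action), there exists a strategy for assigning binary losses (possibly depending on the realized noise parameters) such that the expected regret satisfies Regret(T) ≥ c·T^{2/3}·(ln K)^{1/3}. -/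
open MeasureTheory

/-- Probability of observing feedback `b` for the loss bit `l` when the noise flips it with
probability `p`. -/
def feedbackWeight (l : Bool) (p : ℝ) (b : Bool) : ℝ := if Bool.xor l b then p else 1 - p

lemma feedbackWeight_nonneg {p : ℝ} (h0 : 0 ≤ p) (h1 : p ≤ 1) (l b : Bool) :
    0 ≤ feedbackWeight l p b := by
  unfold feedbackWeight; split_ifs <;> linarith

lemma sum_feedbackWeight (l : Bool) (p : ℝ) : ∑ b, feedbackWeight l p b = 1 := by
  cases l <;> simp [feedbackWeight]

/-- Losses hiding the best action `k`: on the rounds selected by `low` every other action loses,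
and on the remaining rounds nobody does. -/
def hiddenLoss {K T : ℕ} (low : Fin T → Bool) (k j : Fin K) (s : Fin T) : Bool :=
  low s && decide (j ≠ k)

lemma sum_prod_prod_eq {K T : ℕ} (g : Fin T → Fin K → Bool → ℝ) :
    ∑ f : Fin T → Fin K → Bool, ∏ s, ∏ j, g s j (f s j) = ∏ s, ∏ j, ∑ b, g s j b := by
  have h := Fintype.prod_sum (fun (s : Fin T) (h : Fin K → Bool) => ∏ j, g s j (h j))
  rw [← h]
  exact Finset.prod_congr rfl fun s _ => (Fintype.prod_sum (fun j b => g s j b)).symm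

lemma mul_le_of_sq_eq_mul {x n y q c : ℝ} (hn : 0 ≤ n) (hy : 0 ≤ y)
    (hq0 : 0 ≤ q) (hq1 : q ≤ 1) (hc : 0 < c) (h : x ^ 2 = n * y) :
    x * q ≤ c / 2 * n + y * q / (2 * c) := by
  have h1 : x * q ≤ c / 2 * n + y * q ^ 2 / (2 * c) := by
    refine abs_le_of_sq_le_sq' ?_ (by positivity) |>.2
    have h2 : (x * q) ^ 2 = 4 * (c / 2 * n) * (y * q ^ 2 / (2 * c)) := by
      rw [mul_pow, h]; field_simp; ring
    nlinarith [sq_nonneg (c / 2 * n - y * q ^ 2 / (2 * c))]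
  have h3 : y * q ^ 2 ≤ y * q := mul_le_mul_of_nonneg_left (by nlinarith) hy
  have h4 : y * q ^ 2 / (2 * c) ≤ y * q / (2 * c) := by gcongr
  linarith

/-- Chi-square change of measure: averaged over the hidden action, a learner finds it with small
probability. -/
lemma sum_hidden_probability_le {K T : ℕ} (low : Fin T → Bool) (p : Fin T → ℝ) {m c : ℝ}
    (hp0 : ∀ s, 0 ≤ p s) (hp1 : ∀ s, p s ≤ 1)
    (hlow : ∀ s, low s = true → 0 < p s ∧ p s < 1 ∧
      p s ^ 2 / (1 - p s) + (1 - p s) ^ 2 / p s ≤ m) (hc : 0 < c)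
    (q : (Fin T → Fin K → Bool) → Fin K → ℝ) (hq : ∀ f i, 0 ≤ q f i)
    (hq1 : ∀ f, ∑ i, q f i = 1) :
    ∑ k, ∑ f : Fin T → Fin K → Bool,
        (∏ s, ∏ j, feedbackWeight (hiddenLoss low k j s) (p s) (f s j)) * q f k
      ≤ K * (c / 2 * ∏ s, (if low s then m else 1)) + 1 / (2 * c) := by
  set W0 : (Fin T → Fin K → Bool) → ℝ :=
    fun f => ∏ s, ∏ j : Fin K, feedbackWeight (low s) (p s) (f s j) with hW0
  set n : Fin K → Fin T → Fin K → Bool → ℝ := fun k s j b =>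
    if low s = true ∧ j = k then
      feedbackWeight false (p s) b ^ 2 / feedbackWeight true (p s) b
    else feedbackWeight (low s) (p s) b with hn
  have hW0_nonneg : ∀ f, 0 ≤ W0 f := fun f =>
    Finset.prod_nonneg fun s _ => Finset.prod_nonneg fun j _ =>
      feedbackWeight_nonneg (hp0 s) (hp1 s) _ _
  have hn_nonneg : ∀ k s j b, 0 ≤ n k s j b := by
    intro k s j b
    simp only [hn]
    split_ifs
    · exact div_nonneg (sq_nonneg _) (feedbackWeight_nonneg (hp0 s) (hp1 s) _ _)
    · exact feedbackWeight_nonneg (hp0 s) (hp1 s) _ _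
  have hW0_sum : ∑ f, W0 f = 1 := by
    simp only [hW0]
    rw [sum_prod_prod_eq (fun s _ b => feedbackWeight (low s) (p s) b)]
    exact Finset.prod_eq_one fun s _ => Finset.prod_eq_one fun j _ => sum_feedbackWeight _ _
  have hsq : ∀ k f, (∏ s, ∏ j, feedbackWeight (hiddenLoss low k j s) (p s) (f s j)) ^ 2
      = (∏ s, ∏ j, n k s j (f s j)) * W0 f := by
    intro k f
    simp only [hW0, ← Finset.prod_mul_distrib, ← Finset.prod_pow]
    refine Finset.prod_congr rfl fun s _ => Finset.prod_congr rfl fun j _ => ?_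
    by_cases hs : low s = true
    · by_cases hj : j = k
      · have hpos : feedbackWeight true (p s) (f s j) ≠ 0 := by
          obtain ⟨h0, h1, -⟩ := hlow s hs
          unfold feedbackWeight; split_ifs <;> linarith
        simp only [hn, hs, hj, hiddenLoss, and_self, if_true] at hpos ⊢
        simp only [ne_eq, not_true_eq_false, decide_false, Bool.and_false]
        field_simp
      · simp [hn, hs, hj, hiddenLoss, sq]
    · simp [hn, hs, hiddenLoss, sq]
  have hn_sum : ∀ k, ∑ f : Fin T → Fin K → Bool, ∏ s, ∏ j, n k s j (f s j)
      ≤ ∏ s, (if low s then m else 1) := by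
    intro k
    rw [sum_prod_prod_eq]
    refine Finset.prod_le_prod (fun s _ => Finset.prod_nonneg fun j _ =>
      Finset.sum_nonneg fun b _ => hn_nonneg k s j b) fun s _ => ?_
    rw [Finset.prod_eq_single k]
    · by_cases hs : low s = true
      · simpa [hn, hs, feedbackWeight] using (hlow s hs).2.2
      · simp [hn, hs, feedbackWeight]
    · intro j _ hj
      simp only [hn, hj, and_false, if_false]
      exact sum_feedbackWeight _ _
    · simp
  have hq_le : ∀ f i, q f i ≤ 1 := fun f i => by
    rw [← hq1 f]
    exact Finset.single_le_sum (fun j _ => hq f j) (Finset.mem_univ i)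
  calc _ ≤ ∑ k, ∑ f : Fin T → Fin K → Bool,
        (c / 2 * (∏ s, ∏ j, n k s j (f s j)) + W0 f * q f k / (2 * c)) := by
        refine Finset.sum_le_sum fun k _ => Finset.sum_le_sum fun f _ => ?_
        exact mul_le_of_sq_eq_mul (Finset.prod_nonneg fun s _ => Finset.prod_nonneg fun j _ =>
          hn_nonneg k s j _) (hW0_nonneg f) (hq f k) (hq_le f k) hc (hsq k f)
    _ = ∑ k : Fin K, c / 2 * (∑ f : Fin T → Fin K → Bool, ∏ s, ∏ j, n k s j (f s j))
        + 1 / (2 * c) := by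
        simp only [Finset.sum_add_distrib, ← Finset.mul_sum, ← Finset.sum_div]
        rw [Finset.sum_comm (f := fun k f => W0 f * q f k)]
        simp only [← Finset.mul_sum, hq1, mul_one, hW0_sum]
    _ ≤ ∑ k : Fin K, c / 2 * (∏ s, (if low s then m else 1)) + 1 / (2 * c) := by
        gcongr with k
        exact hn_sum k
    _ = _ := by simp

instance inst_s5 : IsProbabilityMeasure uniform01 := ⟨by simp [uniform01]⟩

/-- Probability that a uniform seed falls below `x`. -/
noncomputable def seedProb (x : ℝ) : ℝ := uniform01.real (Set.Iio x)

lemma seedProb_eq {x : ℝ} (h0 : 0 ≤ x) (h1 : x ≤ 1) : seedProb x = x := by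
  have : Set.Iio x ∩ Set.Icc 0 1 = Set.Ico 0 x := by
    ext y; simp only [Set.mem_inter_iff, Set.mem_Iio, Set.mem_Icc, Set.mem_Ico]
    constructor
    · rintro ⟨h, h', -⟩; exact ⟨h', h⟩
    · rintro ⟨h, h'⟩; exact ⟨h', h, by linarith⟩
  rw [seedProb, uniform01, measureReal_restrict_apply measurableSet_Iio, this]
  simp [h0]

lemma measurable_xor_seed (l : Bool) (x : ℝ) :
    Measurable fun u : ℝ => Bool.xor l (decide (u < x)) :=
  (measurable_of_countable (Bool.xor l)).comp
    ((measurable_to_bool (by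
      convert (measurableSet_Iio : MeasurableSet (Set.Iio x)) using 1
      ext; simp)))

lemma map_xor_seed_singleton (l : Bool) (x : ℝ) (b : Bool) :
    (uniform01.map fun u => Bool.xor l (decide (u < x))).real {b}
      = feedbackWeight l (seedProb x) b := by
  rw [map_measureReal_apply (measurable_xor_seed l x) (measurableSet_singleton b)]
  have hc : uniform01.real (Set.Iio x)ᶜ = 1 - uniform01.real (Set.Iio x) :=
    probReal_compl_eq_one_sub measurableSet_Iio
  cases l <;> cases b <;> simp only [feedbackWeight, seedProb, ← hc, Bool.xor] <;>
    simp <;> congr 1 <;> ext u <;> simp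

lemma integral_feedback {K T : ℕ} (l : Fin K → Fin T → Bool) (x : Fin T → ℝ)
    (g : (Fin T → Fin K → Bool) → ℝ) :
    ∫ u : Fin T → Fin K → ℝ, g (fun s j => Bool.xor (l j s) (decide (u s j < x s)))
        ∂(Measure.pi fun _ : Fin T => Measure.pi fun _ : Fin K => uniform01)
      = ∑ f, (∏ s, ∏ j, feedbackWeight (l j s) (seedProb (x s)) (f s j)) * g f := by
  have hm : ∀ s, Measurable fun (v : Fin K → ℝ) (j : Fin K) =>
      Bool.xor (l j s) (decide (v j < x s)) := fun s =>
    measurable_pi_lambda _ fun j => (measurable_xor_seed (l j s) (x s)).comp (measurable_pi_apply j)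
  have hm' : Measurable fun (u : Fin T → Fin K → ℝ) (s : Fin T) (j : Fin K) =>
      Bool.xor (l j s) (decide (u s j < x s)) :=
    measurable_pi_lambda _ fun s => (hm s).comp (measurable_pi_apply s)
  have hprob : ∀ j s, IsProbabilityMeasure
      (uniform01.map fun u => Bool.xor (l j s) (decide (u < x s))) := fun j s =>
    Measure.isProbabilityMeasure_map (measurable_xor_seed _ _).aemeasurable
  have hmap : (Measure.pi fun _ : Fin T => Measure.pi fun _ : Fin K => uniform01).map
        (fun u s j => Bool.xor (l j s) (decide (u s j < x s)))
      = Measure.pi fun s => Measure.pi fun j =>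
        uniform01.map fun u => Bool.xor (l j s) (decide (u < x s)) := by
    have hin : ∀ s, (Measure.pi fun _ : Fin K => uniform01).map
        (fun v j => Bool.xor (l j s) (decide (v j < x s))) = Measure.pi fun j =>
        uniform01.map fun u => Bool.xor (l j s) (decide (u < x s)) := fun s =>
      (Measure.pi_map_pi fun j => (measurable_xor_seed (l j s) (x s)).aemeasurable)
    simp only [← hin]
    have hprob' : ∀ s, IsProbabilityMeasure ((Measure.pi fun _ : Fin K => uniform01).map
        (fun v j => Bool.xor (l j s) (decide (v j < x s)))) := fun s =>
      Measure.isProbabilityMeasure_map (hm s).aemeasurable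
    exact (Measure.pi_map_pi fun s => (hm s).aemeasurable)
  rw [← integral_map (φ := fun (u : Fin T → Fin K → ℝ) (s : Fin T) (j : Fin K) =>
      Bool.xor (l j s) (decide (u s j < x s))) hm'.aemeasurable
      (measurable_of_countable g).aestronglyMeasurable, hmap,
    integral_fintype (Integrable.of_finite)]
  refine Finset.sum_congr rfl fun f _ => ?_
  rw [smul_eq_mul]
  congr 1
  rw [measureReal_def, Measure.pi_singleton, ENNReal.toReal_prod]
  refine Finset.prod_congr rfl fun s _ => ?_
  rw [Measure.pi_singleton, ENNReal.toReal_prod]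
  exact Finset.prod_congr rfl fun j _ => map_xor_seed_singleton _ _ _

/-- The rounds whose noise parameter lies in `[0, δ]`. -/
noncomputable def lowRound {T : ℕ} (δ : ℝ) (e : Fin T → ℝ) (t : Fin T) : Bool :=
  decide (e t ∈ Set.Icc 0 δ)

lemma measurable_lowRound {T : ℕ} (δ : ℝ) (t : Fin T) :
    Measurable fun e : Fin T → ℝ => lowRound δ e t :=
  measurable_to_bool (by
    have h : MeasurableSet ((fun e : Fin T → ℝ => e t) ⁻¹' Set.Icc 0 δ) :=
      measurable_pi_apply t measurableSet_Icc
    convert h using 1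
    ext; simp [lowRound])

lemma integral_ite_lowRound {δ : ℝ} (h0 : 0 ≤ δ) (h1 : δ ≤ 1) (a b : ℝ) :
    ∫ x, (if x ∈ Set.Icc 0 δ then a else b) ∂uniform01 = δ * a + (1 - δ) * b := by
  have h : (fun x : ℝ => if x ∈ Set.Icc 0 δ then a else b)
      = fun x => (Set.Icc 0 δ).indicator (fun _ => a - b) x + b := by
    ext x; by_cases hx : x ∈ Set.Icc 0 δ <;> simp [hx]
  have hr : uniform01.real (Set.Icc 0 δ) = δ := by
    rw [uniform01, measureReal_restrict_apply measurableSet_Icc,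
      Set.inter_eq_left.mpr (Set.Icc_subset_Icc_right h1)]
    simp [h0]
  rw [h, integral_add ((integrable_const _).indicator measurableSet_Icc) (integrable_const _),
    integral_indicator_const _ measurableSet_Icc, hr]
  simp
  ring

lemma integral_lowRound_mul_prod_le {T : ℕ} {δ m : ℝ} (h0 : 0 ≤ δ) (h1 : δ ≤ 1) (hm : 1 ≤ m)
    (t : Fin T) :
    ∫ e : Fin T → ℝ, b2r (lowRound δ e t) * ∏ s, (if lowRound δ e s then m else 1)
        ∂(Measure.pi fun _ => uniform01) ≤ δ * m * Real.exp (T * ((m - 1) * δ)) := by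
  have h : ∀ e : Fin T → ℝ, b2r (lowRound δ e t) * ∏ s, (if lowRound δ e s then m else 1)
      = ∏ s, (fun x : ℝ => if x ∈ Set.Icc 0 δ then m else if s = t then 0 else 1) (e s) := by
    intro e
    rw [← Finset.mul_prod_erase _ _ (Finset.mem_univ t),
      ← Finset.mul_prod_erase (s := Finset.univ) (a := t) _ (Finset.mem_univ t), ← mul_assoc]
    congr 1
    · by_cases ht : e t ∈ Set.Icc 0 δ <;> simp only [lowRound, b2r, ht] <;> simp
    · refine Finset.prod_congr rfl fun s hs => ?_
      simp [lowRound, Finset.ne_of_mem_erase hs]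
  simp only [h]
  rw [integral_fintype_prod_eq_prod (fun (s : Fin T) (x : ℝ) =>
    if x ∈ Set.Icc 0 δ then m else if s = t then 0 else 1), ← Finset.mul_prod_erase _ _ (Finset.mem_univ t)]
  simp only [integral_ite_lowRound h0 h1, if_true, mul_zero, add_zero]
  have hnn : 0 ≤ (m - 1) * δ := mul_nonneg (by linarith) h0
  refine mul_le_mul_of_nonneg_left ?_ (mul_nonneg h0 (by linarith))
  calc _ ≤ ∏ s ∈ Finset.univ.erase t, Real.exp ((m - 1) * δ) := by
        refine Finset.prod_le_prod (fun s _ => ?_) fun s hs => ?_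
        · split_ifs <;> nlinarith
        · rw [if_neg (Finset.ne_of_mem_erase hs)]
          have := Real.add_one_le_exp ((m - 1) * δ)
          linarith
    _ ≤ ∏ s : Fin T, Real.exp ((m - 1) * δ) := by
        rw [← Finset.mul_prod_erase _ _ (Finset.mem_univ t)]
        exact le_mul_of_one_le_left (Finset.prod_nonneg fun _ _ => (Real.exp_pos _).le)
          (Real.one_le_exp hnn)
    _ = _ := by simp [← Real.exp_nat_mul]

lemma sum_hidden_regret_ge {K T : ℕ} {δ c : ℝ} (hδ : δ ≤ 1 / 2) (hc : 0 < c) (e : Fin T → ℝ)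
    (q : Fin T → (Fin T → Fin K → Bool) → Fin K → ℝ) (hq : ∀ t f i, 0 ≤ q t f i)
    (hq1 : ∀ t f, ∑ i, q t f i = 1) :
    ∑ t, b2r (lowRound δ e t) *
        (K - (K * (c / 2 * ∏ s, (if lowRound δ e s then 1 + 6 * δ ^ 2 else 1)) + 1 / (2 * c)))
      ≤ ∑ k, ∫ u : Fin T → Fin K → ℝ, (∑ t, ∑ i,
          q t (fun s j => Bool.xor (hiddenLoss (lowRound δ e) k j s)
            (decide (u s j < (1 - e s) / 2))) i * b2r (hiddenLoss (lowRound δ e) k i t))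
          ∂(Measure.pi fun _ : Fin T => Measure.pi fun _ : Fin K => uniform01) := by
  have hp0 : ∀ s, 0 ≤ seedProb ((1 - e s) / 2) := fun s => measureReal_nonneg
  have hp1 : ∀ s, seedProb ((1 - e s) / 2) ≤ 1 := fun s => measureReal_le_one
  have hlow : ∀ s, lowRound δ e s = true → 0 < seedProb ((1 - e s) / 2) ∧
      seedProb ((1 - e s) / 2) < 1 ∧
      seedProb ((1 - e s) / 2) ^ 2 / (1 - seedProb ((1 - e s) / 2))
        + (1 - seedProb ((1 - e s) / 2)) ^ 2 / seedProb ((1 - e s) / 2) ≤ 1 + 6 * δ ^ 2 := by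
    intro s hs
    obtain ⟨h0, h1⟩ : 0 ≤ e s ∧ e s ≤ δ := by simpa [lowRound] using hs
    rw [seedProb_eq (by linarith) (by linarith)]
    refine ⟨by linarith, by linarith, ?_⟩
    have ha : 0 < 1 - e s := by linarith
    have hb : 0 < 1 + e s := by linarith
    have hsq : e s ^ 2 ≤ δ ^ 2 := by gcongr
    have hsq' : e s ^ 2 ≤ 1 / 4 := by nlinarith
    have heq : ((1 - e s) / 2) ^ 2 / (1 - (1 - e s) / 2) + (1 - (1 - e s) / 2) ^ 2 / ((1 - e s) / 2)
        = (1 + 3 * e s ^ 2) / ((1 - e s) * (1 + e s)) := by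
      have : 1 - (1 - e s) / 2 = (1 + e s) / 2 := by ring
      rw [this]; field_simp; ring
    rw [heq, div_le_iff₀ (by positivity)]
    nlinarith [sq_nonneg (e s)]
  have hinner : ∀ k f t, ∑ i, q t f i * b2r (hiddenLoss (lowRound δ e) k i t)
      = b2r (lowRound δ e t) * (1 - q t f k) := by
    intro k f t
    have : ∀ i, q t f i * b2r (hiddenLoss (lowRound δ e) k i t)
        = b2r (lowRound δ e t) * (q t f i - if i = k then q t f i else 0) := by
      intro i
      by_cases hi : i = k <;> cases h : lowRound δ e t <;> simp [hiddenLoss, hi, h, b2r]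
    simp [this, ← Finset.mul_sum, Finset.sum_sub_distrib, hq1]
  have hP : ∀ k : Fin K, ∑ f : Fin T → Fin K → Bool, ∏ s, ∏ j, feedbackWeight
      (hiddenLoss (lowRound δ e) k j s) (seedProb ((1 - e s) / 2)) (f s j) = 1 := by
    intro k
    rw [sum_prod_prod_eq (fun s j b => feedbackWeight
      (hiddenLoss (lowRound δ e) k j s) (seedProb ((1 - e s) / 2)) b)]
    exact Finset.prod_eq_one fun s _ => Finset.prod_eq_one fun j _ => sum_feedbackWeight _ _
  have hH : ∀ k : Fin K, ∫ u : Fin T → Fin K → ℝ, (∑ t, ∑ i,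
          q t (fun s j => Bool.xor (hiddenLoss (lowRound δ e) k j s)
            (decide (u s j < (1 - e s) / 2))) i * b2r (hiddenLoss (lowRound δ e) k i t))
          ∂(Measure.pi fun _ : Fin T => Measure.pi fun _ : Fin K => uniform01)
      = ∑ t, b2r (lowRound δ e t) * (1 - ∑ f : Fin T → Fin K → Bool, (∏ s, ∏ j, feedbackWeight
        (hiddenLoss (lowRound δ e) k j s) (seedProb ((1 - e s) / 2)) (f s j)) * q t f k) := by
    intro k
    rw [integral_feedback (fun j s => hiddenLoss (lowRound δ e) k j s) (fun s => (1 - e s) / 2)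
      (fun f => ∑ t, ∑ i, q t f i * b2r (hiddenLoss (lowRound δ e) k i t))]
    simp only [hinner, Finset.mul_sum]
    rw [Finset.sum_comm]
    refine Finset.sum_congr rfl fun t _ => ?_
    simp only [mul_left_comm _ (b2r _), mul_sub, mul_one, Finset.sum_sub_distrib,
      ← Finset.mul_sum, ← Finset.sum_mul, hP k, one_mul]
  simp only [hH]
  rw [Finset.sum_comm]
  refine Finset.sum_le_sum fun t _ => ?_
  rw [← Finset.mul_sum, Finset.sum_sub_distrib]
  refine mul_le_mul_of_nonneg_left ?_ (by unfold b2r; split_ifs <;> norm_num)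
  have := sum_hidden_probability_le (lowRound δ e) (fun s => seedProb ((1 - e s) / 2)) hp0 hp1 hlow
    hc (q t) (hq t) (hq1 t)
  simp only [Finset.sum_const, Finset.card_univ, Fintype.card_fin, nsmul_eq_mul, mul_one]
  linarith

lemma measurable_b2r : Measurable b2r := measurable_of_countable _

lemma integral_b2r_lowRound {T : ℕ} {δ : ℝ} (h0 : 0 ≤ δ) (h1 : δ ≤ 1) (t : Fin T) :
    ∫ e : Fin T → ℝ, b2r (lowRound δ e t) ∂(Measure.pi fun _ => uniform01) = δ := by
  have h := integral_comp_eval (μ := fun _ : Fin T => uniform01) (i := t)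
    (f := fun x : ℝ => if x ∈ Set.Icc 0 δ then (1 : ℝ) else 0)
    (Measurable.ite measurableSet_Icc measurable_const measurable_const).aestronglyMeasurable
  rw [integral_ite_lowRound h0 h1] at h
  simpa [lowRound, b2r] using h

lemma integrable_of_measurable_of_abs_le {α : Type*} [MeasurableSpace α] {μ : Measure α}
    [IsFiniteMeasure μ] {f : α → ℝ} (hf : Measurable f) (C : ℝ) (hC : ∀ x, |f x| ≤ C) :
    Integrable f μ :=
  Integrable.of_bound hf.aestronglyMeasurable C (Filter.Eventually.of_forall hC)

lemma b2r_mem_Icc (b : Bool) : b2r b ∈ Set.Icc 0 1 := by cases b <;> simp [b2r]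

lemma integrable_b2r_lowRound {T : ℕ} (δ : ℝ) (t : Fin T) :
    Integrable (fun e : Fin T → ℝ => b2r (lowRound δ e t)) (Measure.pi fun _ => uniform01) :=
  integrable_of_measurable_of_abs_le (measurable_b2r.comp (measurable_lowRound δ t)) 1 fun e => by
    rw [abs_of_nonneg (b2r_mem_Icc _).1]; exact (b2r_mem_Icc _).2

lemma integrable_lowRound_mul_prod {T : ℕ} (δ : ℝ) {m : ℝ} (hm : 1 ≤ m) (t : Fin T) :
    Integrable (fun e : Fin T → ℝ =>
      b2r (lowRound δ e t) * ∏ s, (if lowRound δ e s then m else 1))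
      (Measure.pi fun _ => uniform01) := by
  refine integrable_of_measurable_of_abs_le ?_ (m ^ T) fun e => ?_
  · refine (measurable_b2r.comp (measurable_lowRound δ t)).mul
      (Finset.measurable_prod _ fun s _ => ?_)
    exact (measurable_of_countable (fun b : Bool => if b then m else 1)).comp
      (measurable_lowRound δ s)
  · have hnn : 0 ≤ ∏ s, (if lowRound δ e s then m else 1) :=
      Finset.prod_nonneg fun s _ => by split_ifs <;> linarith
    rw [abs_of_nonneg (mul_nonneg (b2r_mem_Icc _).1 hnn)]
    refine (mul_le_of_le_one_left hnn (b2r_mem_Icc _).2).trans ?_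
    calc _ ≤ ∏ _s : Fin T, m := Finset.prod_le_prod (fun s _ => by split_ifs <;> linarith)
          fun s _ => by split_ifs <;> linarith
      _ = m ^ T := by simp

lemma integrable_algorithm_loss {K T : ℕ} (l : (Fin T → ℝ) → Fin K → Fin T → Bool)
    (hl : ∀ k t, Measurable fun e => l e k t)
    (alg : Fin T → (Fin T → ℝ) → (Fin T → Fin K → Bool) → Fin K → ℝ)
    (h0 : ∀ t e f i, 0 ≤ alg t e f i) (h1 : ∀ t e f, ∑ i, alg t e f i = 1)
    (hmeas : ∀ t f i, Measurable fun e => alg t e f i) :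
    Integrable (fun ω : (Fin T → ℝ) × (Fin T → Fin K → ℝ) => ∑ t, ∑ i,
        alg t ω.1 (fun s j => Bool.xor (l ω.1 j s) (decide (ω.2 s j < (1 - ω.1 s) / 2))) i *
          b2r (l ω.1 i t))
      ((Measure.pi fun _ : Fin T => uniform01).prod
        (Measure.pi fun _ : Fin T => Measure.pi fun _ : Fin K => uniform01)) := by
  have hF : Measurable fun (ω : (Fin T → ℝ) × (Fin T → Fin K → ℝ)) (s : Fin T) (j : Fin K) =>
      Bool.xor (l ω.1 j s) (decide (ω.2 s j < (1 - ω.1 s) / 2)) := by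
    refine measurable_pi_lambda _ fun s => measurable_pi_lambda _ fun j => ?_
    have hd : Measurable fun ω : (Fin T → ℝ) × (Fin T → Fin K → ℝ) =>
        decide (ω.2 s j < (1 - ω.1 s) / 2) := by
      refine measurable_to_bool ?_
      have : MeasurableSet {ω : (Fin T → ℝ) × (Fin T → Fin K → ℝ) |
          ω.2 s j < (1 - ω.1 s) / 2} := measurableSet_lt (by fun_prop) (by fun_prop)
      convert this using 1
      ext; simp
    exact (measurable_of_countable (fun b : Bool × Bool => Bool.xor b.1 b.2)).comp
      (((hl j s).comp measurable_fst).prodMk hd)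
  refine integrable_finsetSum _ fun t _ => integrable_finsetSum _ fun i _ => ?_
  refine integrable_of_measurable_of_abs_le ?_ 1 fun ω => ?_
  · refine Measurable.mul ?_ (measurable_b2r.comp ((hl i t).comp measurable_fst))
    have h : Measurable fun z : (Fin T → ℝ) × (Fin T → Fin K → Bool) => alg t z.1 z.2 i :=
      measurable_from_prod_countable_left fun f => hmeas t f i
    exact h.comp (measurable_fst.prodMk hF)
  · rw [abs_of_nonneg (mul_nonneg (h0 _ _ _ _) (b2r_mem_Icc _).1)]
    refine mul_le_one₀ ?_ (b2r_mem_Icc _).1 (b2r_mem_Icc _).2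
    exact (Finset.single_le_sum (fun j _ => h0 _ _ _ j) (Finset.mem_univ i)).trans_eq (h1 _ _ _)

lemma integrable_sum_lowRound {T : ℕ} (K : ℕ) (δ c : ℝ) {m : ℝ} (hm : 1 ≤ m) :
    Integrable (fun e : Fin T → ℝ => ∑ t, b2r (lowRound δ e t) *
        (K - (K * (c / 2 * ∏ s, (if lowRound δ e s then m else 1)) + 1 / (2 * c))))
      (Measure.pi fun _ => uniform01) := by
  refine integrable_finsetSum _ fun t _ => ?_
  refine (((integrable_b2r_lowRound δ t).mul_const (K - 1 / (2 * c))).sub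
    ((integrable_lowRound_mul_prod δ hm t).mul_const (K * (c / 2)))).congr
      (Filter.Eventually.of_forall fun e => ?_)
  simp only [Pi.sub_apply]
  ring

lemma integral_sum_lowRound_ge {T K : ℕ} {δ c m : ℝ} (h0 : 0 ≤ δ) (h1 : δ ≤ 1) (hc : 0 < c)
    (hm : 1 ≤ m) :
    T * (δ * (K - 1 / (2 * c)) - δ * m * Real.exp (T * ((m - 1) * δ)) * (K * (c / 2))) ≤
      ∫ e : Fin T → ℝ, (∑ t, b2r (lowRound δ e t) *
        (K - (K * (c / 2 * ∏ s, (if lowRound δ e s then m else 1)) + 1 / (2 * c))))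
      ∂(Measure.pi fun _ => uniform01) := by
  have h : ∀ (e : Fin T → ℝ) t, b2r (lowRound δ e t) *
        (K - (K * (c / 2 * ∏ s, (if lowRound δ e s then m else 1)) + 1 / (2 * c)))
      = b2r (lowRound δ e t) * (K - 1 / (2 * c))
        - (b2r (lowRound δ e t) * ∏ s, (if lowRound δ e s then m else 1)) * (K * (c / 2)) := by
    intro e t; ring
  have hi := fun t : Fin T => (integrable_b2r_lowRound δ t).mul_const ((K : ℝ) - 1 / (2 * c))
  have hi' := fun t : Fin T => (integrable_lowRound_mul_prod δ hm t).mul_const ((K : ℝ) * (c / 2))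
  simp only [h]
  rw [integral_finsetSum _ fun t _ => by exact (hi t).sub (hi' t)]
  calc _ = ∑ t : Fin T, (δ * (K - 1 / (2 * c))
        - δ * m * Real.exp (T * ((m - 1) * δ)) * (K * (c / 2))) := by
        rw [Finset.sum_const, Finset.card_univ, Fintype.card_fin, nsmul_eq_mul]
    _ ≤ _ := Finset.sum_le_sum fun t _ => by
        rw [integral_sub (hi t) (hi' t), integral_mul_const, integral_mul_const,
          integral_b2r_lowRound h0 h1]
        gcongr
        exact integral_lowRound_mul_prod_le h0 h1 hm t

/-- For a suitable hidden action, the expected loss of the learner is at least half the expected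
number of rounds with low noise parameter. -/
lemma exists_hidden_regret_ge {K T : ℕ} {δ : ℝ} (hK : 0 < K) (hlog : 18 ≤ Real.log K)
    (h0 : 0 ≤ δ) (hδ : δ ≤ 1 / 2) (hT : T * δ ^ 3 = Real.log K / 27)
    (alg : Fin T → (Fin T → ℝ) → (Fin T → Fin K → Bool) → Fin K → ℝ)
    (halg0 : ∀ t e f i, 0 ≤ alg t e f i) (halg1 : ∀ t e f, ∑ i, alg t e f i = 1)
    (hmeas : ∀ t f i, Measurable fun e => alg t e f i) :
    ∃ k : Fin K, T * δ / 2 ≤ ∫ ω : (Fin T → ℝ) × (Fin T → Fin K → ℝ),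
        (∑ t, ∑ i, alg t ω.1 (fun s j => Bool.xor (hiddenLoss (lowRound δ ω.1) k j s)
            (decide (ω.2 s j < (1 - ω.1 s) / 2))) i * b2r (hiddenLoss (lowRound δ ω.1) k i t))
        ∂((Measure.pi fun _ : Fin T => uniform01).prod
          (Measure.pi fun _ : Fin T => Measure.pi fun _ : Fin K => uniform01)) := by
  set c : ℝ := Real.exp (-(Real.log K / 2)) with hc
  have hc0 : 0 < c := Real.exp_pos _
  have hKpos : (0 : ℝ) < K := by exact_mod_cast hK
  have hm : (1 : ℝ) ≤ 1 + 6 * δ ^ 2 := by nlinarith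
  have hmeasl : ∀ k j s, Measurable fun e : Fin T → ℝ =>
      hiddenLoss (K := K) (lowRound δ e) k j s := fun k j s =>
    (measurable_of_countable (fun b : Bool => b && decide (j ≠ k))).comp (measurable_lowRound δ s)
  have hint := fun k => integrable_algorithm_loss
    (fun e j s => hiddenLoss (lowRound δ e) k j s) (hmeasl k) alg halg0 halg1 hmeas
  obtain ⟨k, -, hk⟩ : ∃ k ∈ (Finset.univ : Finset (Fin K)), T * δ / 2 ≤
      ∫ ω : (Fin T → ℝ) × (Fin T → Fin K → ℝ),
        (∑ t, ∑ i, alg t ω.1 (fun s j => Bool.xor (hiddenLoss (lowRound δ ω.1) k j s)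
            (decide (ω.2 s j < (1 - ω.1 s) / 2))) i * b2r (hiddenLoss (lowRound δ ω.1) k i t))
        ∂((Measure.pi fun _ : Fin T => uniform01).prod
          (Measure.pi fun _ : Fin T => Measure.pi fun _ : Fin K => uniform01)) := by
    refine Finset.exists_le_of_sum_le ⟨⟨0, hK⟩, Finset.mem_univ _⟩ ?_
    simp only [fun k => integral_prod _ (hint k)]
    rw [← integral_finsetSum _ fun k _ => (hint k).integral_prod_left]
    refine le_trans ?_ (integral_mono (integrable_sum_lowRound K δ c hm)
      (integrable_finsetSum _ fun k _ => (hint k).integral_prod_left)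
      fun e => sum_hidden_regret_ge hδ hc0 e (fun t f i => alg t e f i)
        (fun t => halg0 t e) (fun t => halg1 t e))
    refine le_trans ?_ (integral_sum_lowRound_ge h0 (by linarith) hc0 hm)
    have hexp : (T : ℝ) * ((1 + 6 * δ ^ 2 - 1) * δ) = 2 / 9 * Real.log K := by
      linear_combination 6 * hT
    have hfirst : 1 / (2 * c) ≤ K / 4 := by
      have h9 : (2 : ℝ) ≤ Real.exp (Real.log K / 2) := by
        linarith [Real.add_one_le_exp (Real.log K / 2)]
      have hsq : (K : ℝ) = Real.exp (Real.log K / 2) * Real.exp (Real.log K / 2) := by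
        rw [← Real.exp_add, add_halves, Real.exp_log hKpos]
      have hcinv : 1 / (2 * c) = Real.exp (Real.log K / 2) / 2 := by
        rw [hc, Real.exp_neg]; field_simp
      rw [hcinv]
      nlinarith
    have hsecond : (1 + 6 * δ ^ 2) * Real.exp (2 / 9 * Real.log K) * (c / 2) ≤ 1 / 4 := by
      have h5 : Real.exp (2 / 9 * Real.log K) * c ≤ 1 / 6 := by
        rw [hc, ← Real.exp_add]
        calc _ ≤ Real.exp (-5) := Real.exp_le_exp.mpr (by linarith)
          _ ≤ 1 / 6 := by
            rw [Real.exp_neg, ← one_div]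
            exact one_div_le_one_div_of_le (by norm_num)
              (by linarith [Real.add_one_le_exp (5 : ℝ)])
      have hm' : 1 + 6 * δ ^ 2 ≤ 5 / 2 := by nlinarith
      have hpos : 0 ≤ Real.exp (2 / 9 * Real.log K) * c := by positivity
      nlinarith
    rw [hexp]
    simp only [Finset.sum_const, Finset.card_univ, Fintype.card_fin, nsmul_eq_mul]
    have h2 := mul_le_mul_of_nonneg_left hsecond hKpos.le
    have hT0 : 0 ≤ (T : ℝ) * δ := by positivity
    have := mul_le_mul_of_nonneg_left (add_le_add hfirst h2) hT0
    linarith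
  exact ⟨k, hk⟩

/-- lower bound for Full Information with Variable Noise under the common-noise
distribution `D'` (a single `ε_t ~ U(0,1)` shared by all actions).  Sample space:
`ω.1 t = ε_t` and `ω.2 t i` is a uniform seed generating the Bernoulli((1-ε_t)/2) noise bit of
action `i` at round `t`.  The algorithm observes the realized noise parameters of rounds `≤ t`
and the noisy feedbacks of rounds `< t`; the loss strategy may depend on the realized noise. -/
theorem full_info_variable_noise_lower_bound :
    ∃ c : ℝ, 0 < c ∧
      ∀ (K T : ℕ) (hK : 2 ≤ K), (18 : ℝ) ≤ Real.log K →
        2 * Real.log K ≤ (T : ℝ) ^ ((2 : ℝ) / 3) * Real.log K ^ ((1 : ℝ) / 3) →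
        ∀ alg : Fin T → (Fin T → ℝ) → (Fin T → Fin K → Bool) → Fin K → ℝ,
          (∀ t e e' f f', (∀ s : Fin T, s ≤ t → e s = e' s) →
            (∀ s : Fin T, s < t → f s = f' s) → alg t e f = alg t e' f') →
          (∀ t e f i, 0 ≤ alg t e f i) →
          (∀ t e f, ∑ i, alg t e f i = 1) →
          (∀ t f i, Measurable fun e => alg t e f i) →
          ∃ ℓ : (Fin T → ℝ) → Fin K → Fin T → Bool,
            (∀ k t, Measurable fun e => ℓ e k t) ∧
            c * (T : ℝ) ^ ((2 : ℝ) / 3) * Real.log K ^ ((1 : ℝ) / 3) ≤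
              (∫ ω : (Fin T → ℝ) × (Fin T → Fin K → ℝ),
                  (∑ t, ∑ i,
                    alg t ω.1
                      (fun s j => Bool.xor (ℓ ω.1 j s) (decide (ω.2 s j < (1 - ω.1 s) / 2))) i *
                      b2r (ℓ ω.1 i t))
                  ∂((Measure.pi fun _ : Fin T => uniform01).prod
                      (Measure.pi fun _ : Fin T => Measure.pi fun _ : Fin K => uniform01)))
                - Finset.univ.inf' (Finset.univ_nonempty_iff.mpr ⟨⟨0, by omega⟩⟩)
                    (fun k =>
                      ∫ ω : (Fin T → ℝ) × (Fin T → Fin K → ℝ),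
                        (∑ t, b2r (ℓ ω.1 k t))
                        ∂((Measure.pi fun _ : Fin T => uniform01).prod
                            (Measure.pi fun _ : Fin T => Measure.pi fun _ : Fin K => uniform01))) := by
  refine ⟨1 / 6, by norm_num, fun K T hK hlog hTK alg _ halg0 halg1 hmeas => ?_⟩
  set a : ℝ := (T : ℝ) ^ ((1 : ℝ) / 3) with ha
  set b : ℝ := Real.log K ^ ((1 : ℝ) / 3) with hb
  have ha3 : a ^ 3 = T := by
    rw [ha, ← Real.rpow_natCast, ← Real.rpow_mul (by positivity)]; norm_num
  have hb3 : b ^ 3 = Real.log K := by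
    rw [hb, ← Real.rpow_natCast, ← Real.rpow_mul (by linarith)]; norm_num
  have ha2 : (T : ℝ) ^ ((2 : ℝ) / 3) = a ^ 2 := by
    rw [ha, ← Real.rpow_natCast, ← Real.rpow_mul (by positivity)]; norm_num
  have hb0 : 0 < b := Real.rpow_pos_of_pos (by linarith) _
  rw [ha2, ← hb3] at hTK
  have hab : b ^ 2 ≤ a ^ 2 := by
    have : 2 * b ^ 2 ≤ a ^ 2 := le_of_mul_le_mul_right (by linarith) hb0
    nlinarith
  have hba : b ≤ a := (sq_le_sq₀ hb0.le (by positivity)).mp hab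
  have ha0 : 0 < a := hb0.trans_le hba
  obtain ⟨k, hk⟩ := exists_hidden_regret_ge (δ := b / (3 * a)) (by omega) hlog (by positivity)
    (by rw [div_le_iff₀ (by positivity)]; linarith)
    (by rw [← ha3, ← hb3]; field_simp; norm_num) alg halg0 halg1 hmeas
  refine ⟨fun e j s => hiddenLoss (lowRound (b / (3 * a)) e) k j s, fun j s =>
    (measurable_of_countable (fun x : Bool => x && decide (j ≠ k))).comp
      (measurable_lowRound _ s), ?_⟩
  have hmain : 1 / 6 * (T : ℝ) ^ ((2 : ℝ) / 3) * b = T * (b / (3 * a)) / 2 := by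
    rw [ha2, ← ha3]; field_simp; norm_num
  rw [hmain]
  refine le_trans (le_trans hk (sub_zero _).ge) (sub_le_sub_left ?_ _)
  refine (Finset.inf'_le _ (Finset.mem_univ k)).trans_eq ?_
  simp [hiddenLoss, b2r]
end

section
/- Let α > 0. There exists a constant C depending only on α with the following property. Let K ≥ 2 and let D be a distribution over [0,1]^K whose coordinate marginals are all equal, supported on (0,1), with common CDF F satisfying F(θ) ≤ θ^α for all θ ∈ (0,1). Then, for any binary loss sequence, running the EW-Threshold algorithm in the variable-noise full-information model with θ = (2/α)^{1/(1+α)}·((ln K)/T)^{1/(2(1+α))} and η = √((ln K)/(T·g(θ))), where g(θ) = E[ε^{-2}·1{ε ≥ θ}], and assuming T is large enough that θ ≤ 1, yields Regret(T) ≤ C·T^{(2+α)/(2+2α)}·(ln K)^{α/(2(1+α))}. -/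
open MeasureTheory

/-- Closed form of the multiplicative weight update. -/
theorem expWeights_eq_exp_sum {ι : Type*} {T : ℕ} {w : ι → ℕ → ℝ} {x : ι → Fin T → ℝ} {η : ℝ}
    (h0 : ∀ i, w i 0 = 1)
    (hs : ∀ i (t : Fin T), w i ((t : ℕ) + 1) = w i t * Real.exp (-η * x i t))
    (i : ι) {n : ℕ} (hn : n ≤ T) :
    w i n = Real.exp (-η * ∑ s ∈ Finset.univ.filter (fun s : Fin T => (s : ℕ) < n), x i s) := by
  induction n with
  | zero => simp [h0]
  | succ n ih =>
    have hfilter : Finset.univ.filter (fun s : Fin T => (s : ℕ) < n + 1) =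
        insert ⟨n, hn⟩ (Finset.univ.filter (fun s : Fin T => (s : ℕ) < n)) := by
      ext s
      simp only [Finset.mem_filter, Finset.mem_univ, true_and, Finset.mem_insert, Fin.ext_iff]
      omega
    rw [hfilter, Finset.sum_insert (by simp), mul_add, Real.exp_add]
    have := hs i ⟨n, hn⟩
    simp only at this
    rw [this, ih (by omega), mul_comm]

/-- Second-order regret bound for exponential weights with losses of magnitude at most `1 / η`. -/
theorem expWeights_regret_le {ι : Type*} [Fintype ι] {T : ℕ} {w : ι → ℕ → ℝ}
    {x : ι → Fin T → ℝ} {η : ℝ} (h0 : ∀ i, w i 0 = 1)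
    (hs : ∀ i (t : Fin T), w i ((t : ℕ) + 1) = w i t * Real.exp (-η * x i t))
    (hx : ∀ i t, |η * x i t| ≤ 1) (k : ι) :
    η * (∑ t : Fin T, ∑ i, w i t / (∑ j, w j t) * x i t - ∑ t, x k t) ≤
      Real.log (Fintype.card ι) +
        η ^ 2 * ∑ t : Fin T, ∑ i, w i t / (∑ j, w j t) * x i t ^ 2 := by
  have hpos : ∀ i (n : ℕ), n ≤ T → 0 < w i n := fun i n hn => by
    rw [expWeights_eq_exp_sum h0 hs i hn]; exact Real.exp_pos _
  set W : ℕ → ℝ := fun n => ∑ j, w j n with hW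
  have hWpos : ∀ n, n ≤ T → 0 < W n := fun n hn =>
    Finset.sum_pos (fun i _ => hpos i n hn) ⟨k, Finset.mem_univ k⟩
  have hstep : ∀ t : Fin T, Real.log (W ((t : ℕ) + 1)) - Real.log (W t) ≤
      -η * ∑ i, w i t / W t * x i t + η ^ 2 * ∑ i, w i t / W t * x i t ^ 2 := by
    intro t
    have hWt := hWpos t t.2.le
    rw [← Real.log_div (hWpos _ t.2).ne' hWt.ne']
    refine (Real.log_le_sub_one_of_pos (div_pos (hWpos _ t.2) hWt)).trans ?_
    have hexpand : (-η * ∑ i, w i t / W t * x i t + η ^ 2 * ∑ i, w i t / W t * x i t ^ 2 + 1) * W t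
        = ∑ i, w i t * (1 + -η * x i t + (-η * x i t) ^ 2) := by
      have h1 : (∑ i, w i t / W t * x i t) * W t = ∑ i, w i t * x i t := by
        rw [Finset.sum_mul]
        exact Finset.sum_congr rfl fun i _ => by field_simp
      have h2 : (∑ i, w i t / W t * x i t ^ 2) * W t = ∑ i, w i t * x i t ^ 2 := by
        rw [Finset.sum_mul]
        exact Finset.sum_congr rfl fun i _ => by field_simp
      rw [add_mul, add_mul, mul_assoc, mul_assoc, h1, h2, one_mul, Finset.mul_sum, Finset.mul_sum]
      simp only [hW]
      rw [← Finset.sum_add_distrib, ← Finset.sum_add_distrib]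
      exact Finset.sum_congr rfl fun i _ => by ring
    rw [sub_le_iff_le_add, div_le_iff₀ hWt, hexpand]
    refine Finset.sum_le_sum fun i _ => ?_
    rw [hs i t]
    have hexp : Real.exp (-η * x i t) ≤ 1 + -η * x i t + (-η * x i t) ^ 2 := by
      have := Real.abs_exp_sub_one_sub_id_le (x := -η * x i t)
        (by rw [neg_mul, abs_neg]; exact hx i t)
      linarith [(abs_le.mp this).2]
    exact mul_le_mul_of_nonneg_left hexp (hpos i t t.2.le).le
  have htel : ∑ t : Fin T, (Real.log (W ((t : ℕ) + 1)) - Real.log (W t)) =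
      Real.log (W T) - Real.log (W 0) := by
    rw [Fin.sum_univ_eq_sum_range (fun n => Real.log (W (n + 1)) - Real.log (W n)) T,
      Finset.sum_range_sub (fun n => Real.log (W n))]
  have hsum := Finset.sum_le_sum (s := Finset.univ) fun t _ => hstep t
  rw [htel, Finset.sum_add_distrib, ← Finset.mul_sum, ← Finset.mul_sum] at hsum
  have hW0 : W 0 = Fintype.card ι := by simp [hW, h0]
  have hk : -η * ∑ t, x k t ≤ Real.log (W T) := by
    have hwk : w k T ≤ W T :=
      Finset.single_le_sum (f := fun j => w j T) (fun i _ => (hpos i T le_rfl).le)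
        (Finset.mem_univ k)
    have := Real.log_le_log (hpos k T le_rfl) hwk
    rw [expWeights_eq_exp_sum h0 hs k le_rfl, Real.log_exp] at this
    simpa using this
  rw [hW0] at hsum
  linarith

/-- Expected regret of exponential weights run on independent noisy losses whose means are a common
multiple `G` of the true losses. -/
theorem expWeights_expected_regret_le {Ω ι : Type*} [MeasurableSpace Ω] [Fintype ι] {T : ℕ}
    {μ : Measure Ω} [IsProbabilityMeasure μ] {x : Ω → ι → Fin T → ℝ} {w : Ω → ι → ℕ → ℝ}
    {b : ι → Fin T → ℝ} {η G V : ℝ} (hη : 0 < η)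
    (hmeas : ∀ i t, Measurable fun ω => x ω i t)
    (hindep : ProbabilityTheory.iIndepFun (fun t ω i => x ω i t) μ)
    (hbound : ∀ᵐ ω ∂μ, ∀ i t, |η * x ω i t| ≤ 1)
    (hmean : ∀ i t, ∫ ω, x ω i t ∂μ = G * b i t)
    (hvar : ∀ i t, ∫ ω, x ω i t ^ 2 ∂μ ≤ V)
    (h0 : ∀ ω i, w ω i 0 = 1)
    (hs : ∀ ω i (t : Fin T), w ω i ((t : ℕ) + 1) = w ω i t * Real.exp (-η * x ω i t)) (k : ι) :
    η * (G * (∫ ω, (∑ t : Fin T, ∑ i, w ω i t / (∑ j, w ω j t) * b i t) ∂μ - ∑ t, b k t)) ≤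
      Real.log (Fintype.card ι) + η ^ 2 * (T * V) := by
  have hpos : ∀ ω i (n : ℕ), n ≤ T → 0 < w ω i n := fun ω i n hn => by
    rw [expWeights_eq_exp_sum (h0 ω) (hs ω) i hn]; exact Real.exp_pos _
  have hWpos : ∀ ω (t : Fin T), 0 < ∑ j, w ω j t := fun ω t =>
    Finset.sum_pos (fun i _ => hpos ω i t t.2.le) ⟨k, Finset.mem_univ k⟩
  set q : Ω → ι → Fin T → ℝ := fun ω i t => w ω i t / ∑ j, w ω j t with hq
  have hq0 : ∀ ω i t, 0 ≤ q ω i t := fun ω i t =>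
    div_nonneg (hpos ω i t t.2.le).le (hWpos ω t).le
  have hqsum : ∀ ω t, ∑ i, q ω i t = 1 := fun ω t => by
    simp only [hq]
    rw [← Finset.sum_div, div_self (hWpos ω t).ne']
  have hq1 : ∀ ω i t, q ω i t ≤ 1 := fun ω i t => by
    rw [← hqsum ω t]
    exact Finset.single_le_sum (f := fun i => q ω i t) (fun i _ => hq0 ω i t) (Finset.mem_univ i)
  have hwmeas : ∀ i (t : Fin T), Measurable fun ω => w ω i t := fun i t => by
    simp_rw [fun ω => expWeights_eq_exp_sum (h0 ω) (hs ω) i t.2.le]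
    fun_prop
  have hqmeas : ∀ i t, Measurable fun ω => q ω i t := fun i t =>
    (hwmeas i t).div (Finset.measurable_sum _ fun j _ => hwmeas j t)
  have hqx : ∀ i t, ProbabilityTheory.IndepFun (fun ω => q ω i t) (fun ω => x ω i t) μ := by
    intro i t
    let S : Finset (Fin T) := Finset.univ.filter fun s => (s : ℕ) < t
    have hdisj : Disjoint S {t} := by simp [S]
    have hI := hindep.indepFun_finset S {t} hdisj
      fun s => measurable_pi_lambda _ fun i => hmeas i s
    let φ : ι → (S → ι → ℝ) → ℝ := fun j y => Real.exp (-η * ∑ s : S, y s j)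
    have hφ : ∀ j, Measurable (φ j) := fun j => by
      simp only [φ]; fun_prop
    have hφw : ∀ j ω, φ j (fun s : S => fun i => x ω i s) = w ω j t := fun j ω => by
      rw [expWeights_eq_exp_sum (h0 ω) (hs ω) j t.2.le]
      simp only [φ]
      rw [← Finset.sum_coe_sort S (fun s => x ω j s)]
    have hψ : Measurable fun y => φ i y / ∑ j, φ j y :=
      (hφ i).div (Finset.measurable_sum _ fun j _ => hφ j)
    have hχ : Measurable fun y : (({t} : Finset (Fin T)) → ι → ℝ) =>
        y ⟨t, Finset.mem_singleton_self t⟩ i := by fun_prop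
    have hqψ : (fun ω => q ω i t) =
        (fun y => φ i y / ∑ j, φ j y) ∘ fun ω (s : S) i => x ω i s := by
      ext ω
      simp only [hq, Function.comp, hφw]
    rw [hqψ]
    exact hI.comp hψ hχ
  have hint_q : ∀ i t, Integrable (fun ω => q ω i t) μ := fun i t =>
    Integrable.of_bound (hqmeas i t).aestronglyMeasurable 1 <| ae_of_all _ fun ω => by
      rw [Real.norm_of_nonneg (hq0 ω i t)]; exact hq1 ω i t
  have hxle : ∀ᵐ ω ∂μ, ∀ i t, ‖x ω i t‖ ≤ 1 / η := by
    filter_upwards [hbound] with ω hω i t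
    have := hω i t
    rw [abs_mul, abs_of_pos hη] at this
    rw [Real.norm_eq_abs, le_div_iff₀ hη]
    linarith
  have hint_x : ∀ i t, Integrable (fun ω => x ω i t) μ := fun i t =>
    Integrable.of_bound (hmeas i t).aestronglyMeasurable (1 / η) <| by
      filter_upwards [hxle] with ω hω using hω i t
  have hint_x2 : ∀ i t, Integrable (fun ω => x ω i t ^ 2) μ := fun i t =>
    Integrable.of_bound ((hmeas i t).pow_const 2).aestronglyMeasurable ((1 / η) ^ 2) <| by
      filter_upwards [hxle] with ω hω
      rw [norm_pow]
      exact pow_le_pow_left₀ (norm_nonneg _) (hω i t) 2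
  have hqx2 : ∀ i t, ProbabilityTheory.IndepFun (fun ω => q ω i t) (fun ω => x ω i t ^ 2) μ := fun i t =>
    (hqx i t).comp measurable_id (measurable_id.pow_const 2)
  have hint_qx : ∀ i t, Integrable (fun ω => q ω i t * x ω i t) μ := fun i t =>
    (hqx i t).integrable_mul (hint_q i t) (hint_x i t)
  have hint_qx2 : ∀ i t, Integrable (fun ω => q ω i t * x ω i t ^ 2) μ := fun i t =>
    (hqx2 i t).integrable_mul (hint_q i t) (hint_x2 i t)
  have hint_S : Integrable (fun ω => ∑ t, ∑ i, q ω i t * x ω i t) μ :=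
    integrable_finsetSum _ fun t _ => integrable_finsetSum _ fun i _ => hint_qx i t
  have hint_k : Integrable (fun ω => ∑ t, x ω k t) μ :=
    integrable_finsetSum _ fun t _ => hint_x k t
  have hint_V : Integrable (fun ω => ∑ t, ∑ i, q ω i t * x ω i t ^ 2) μ :=
    integrable_finsetSum _ fun t _ => integrable_finsetSum _ fun i _ => hint_qx2 i t
  have hmono : ∫ ω, η * (∑ t, ∑ i, q ω i t * x ω i t - ∑ t, x ω k t) ∂μ ≤
      ∫ ω, (Real.log (Fintype.card ι) + η ^ 2 * ∑ t, ∑ i, q ω i t * x ω i t ^ 2) ∂μ := by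
    refine integral_mono_ae ((hint_S.sub hint_k).const_mul η)
      ((integrable_const _).add (hint_V.const_mul _)) ?_
    filter_upwards [hbound] with ω hω
    exact expWeights_regret_le (h0 ω) (hs ω) hω k
  rw [integral_const_mul, integral_sub hint_S hint_k,
    integral_add (integrable_const _) (hint_V.const_mul _), integral_const_mul,
    integral_const, probReal_univ, one_smul] at hmono
  have hES : ∫ ω, ∑ t, ∑ i, q ω i t * x ω i t ∂μ =
      G * ∫ ω, ∑ t, ∑ i, q ω i t * b i t ∂μ := by
    rw [integral_finsetSum _ fun t _ => integrable_finsetSum _ fun i _ => hint_qx i t,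
      integral_finsetSum _ fun t _ =>
        integrable_finsetSum _ fun i _ => (hint_q i t).mul_const _, Finset.mul_sum]
    refine Finset.sum_congr rfl fun t _ => ?_
    rw [integral_finsetSum _ fun i _ => hint_qx i t,
      integral_finsetSum _ fun i _ => (hint_q i t).mul_const _, Finset.mul_sum]
    refine Finset.sum_congr rfl fun i _ => ?_
    rw [(hqx i t).integral_fun_mul_eq_mul_integral (hqmeas i t).aestronglyMeasurable
      (hmeas i t).aestronglyMeasurable, hmean, integral_mul_const]
    ring
  have hEk : ∫ ω, ∑ t, x ω k t ∂μ = G * ∑ t, b k t := by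
    rw [integral_finsetSum _ fun t _ => hint_x k t, Finset.mul_sum]
    exact Finset.sum_congr rfl fun t _ => hmean k t
  have hEV : ∫ ω, ∑ t, ∑ i, q ω i t * x ω i t ^ 2 ∂μ ≤ T * V := by
    have hround : ∀ t, ∫ ω, ∑ i, q ω i t * x ω i t ^ 2 ∂μ ≤ V := by
      intro t
      calc ∫ ω, ∑ i, q ω i t * x ω i t ^ 2 ∂μ
          = ∑ i, (∫ ω, q ω i t ∂μ) * ∫ ω, x ω i t ^ 2 ∂μ := by
            rw [integral_finsetSum _ fun i _ => hint_qx2 i t]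
            refine Finset.sum_congr rfl fun i _ => ?_
            exact (hqx2 i t).integral_fun_mul_eq_mul_integral (hqmeas i t).aestronglyMeasurable
              ((hmeas i t).pow_const 2).aestronglyMeasurable
        _ ≤ ∑ i, (∫ ω, q ω i t ∂μ) * V := Finset.sum_le_sum fun i _ =>
            mul_le_mul_of_nonneg_left (hvar i t) (integral_nonneg fun ω => hq0 ω i t)
        _ = V := by
            rw [← Finset.sum_mul, ← integral_finsetSum _ fun i _ => hint_q i t]
            simp [hqsum]
    rw [integral_finsetSum _ fun t _ => integrable_finsetSum _ fun i _ => hint_qx2 i t]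
    refine (Finset.sum_le_sum fun t _ => hround t).trans (le_of_eq ?_)
    simp
  rw [hES, hEk, ← mul_sub] at hmono
  exact hmono.trans (add_le_add le_rfl (mul_le_mul_of_nonneg_left hEV (sq_nonneg η)))

/-- Pairing the coordinates of two product measures gives independent variables. -/
theorem iIndepFun_prodMk_eval {ι α β : Type*} [Fintype ι] [MeasurableSpace α] [MeasurableSpace β]
    (μ : Measure α) (ν : Measure β) [IsProbabilityMeasure μ] [IsProbabilityMeasure ν] :
    ProbabilityTheory.iIndepFun (fun (t : ι) (ω : (ι → α) × (ι → β)) => (ω.1 t, ω.2 t))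
      ((Measure.pi fun _ : ι => μ).prod (Measure.pi fun _ : ι => ν)) := by
  have hmap : ∀ t : ι, ((Measure.pi fun _ : ι => μ).prod (Measure.pi fun _ : ι => ν)).map
      (fun ω => (ω.1 t, ω.2 t)) = μ.prod ν := fun t =>
    ((measurePreserving_eval (fun _ : ι => μ) t).prod
      (measurePreserving_eval (fun _ : ι => ν) t)).map_eq
  rw [ProbabilityTheory.iIndepFun_iff_map_fun_eq_pi_map fun t => by fun_prop]
  simp_rw [hmap]
  exact ((measurePreserving_arrowProdEquivProdArrow α β ι (fun _ => μ) (fun _ => ν)).symm).map_eq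

/-- The thresholded unbiased estimate of the loss `b` from feedback with noise parameter `e`,
the noise bit being `u < (1 - e) / 2`. -/
noncomputable def thresholdEstimate (θ : ℝ) (b : Bool) (e u : ℝ) : ℝ :=
  (b2r (Bool.xor b (decide (u < (1 - e) / 2))) - (1 - e) / 2) / (1 - 2 * ((1 - e) / 2)) *
    (if θ ≤ e then 1 else 0)

theorem b2r_xor_decide (b : Bool) (p : Prop) [Decidable p] :
    b2r (Bool.xor b (decide p)) = if p then 1 - b2r b else b2r b := by
  by_cases hp : p <;> cases b <;> simp [hp, b2r]

theorem b2r_nonneg (b : Bool) : 0 ≤ b2r b := by cases b <;> simp [b2r]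

theorem b2r_le_one (b : Bool) : b2r b ≤ 1 := by cases b <;> simp [b2r]

theorem measurable_thresholdEstimate (θ : ℝ) (b : Bool) :
    Measurable fun z : ℝ × ℝ => thresholdEstimate θ b z.1 z.2 := by
  simp only [thresholdEstimate, b2r_xor_decide]
  have h1 : Measurable fun z : ℝ × ℝ => if z.2 < (1 - z.1) / 2 then 1 - b2r b else b2r b :=
    Measurable.ite (measurableSet_lt (by fun_prop) (by fun_prop)) measurable_const measurable_const
  have h2 : Measurable fun z : ℝ × ℝ => if θ ≤ z.1 then (1 : ℝ) else 0 :=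
    Measurable.ite (measurableSet_le (by fun_prop) (by fun_prop)) measurable_const measurable_const
  exact ((h1.sub (by fun_prop)).div (by fun_prop)).mul h2

theorem sq_thresholdEstimate_le (θ : ℝ) (b : Bool) {e : ℝ} (he : e ∈ Set.Ioo (0 : ℝ) 1) (u : ℝ) :
    thresholdEstimate θ b e u ^ 2 ≤ if θ ≤ e then (e ^ 2)⁻¹ else 0 := by
  obtain ⟨he0, he1⟩ := he
  unfold thresholdEstimate
  split_ifs with h
  · have hden : 1 - 2 * ((1 - e) / 2) = e := by ring
    rw [hden, mul_one, div_pow, div_eq_mul_inv]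
    refine mul_le_of_le_one_left (by positivity) ?_
    rw [sq_le_one_iff_abs_le_one, abs_le]
    have h0 := b2r_nonneg (Bool.xor b (decide (u < (1 - e) / 2)))
    have h1 := b2r_le_one (Bool.xor b (decide (u < (1 - e) / 2)))
    constructor <;> linarith
  · simp

theorem sq_thresholdEstimate_le_of_pos {θ : ℝ} (hθ : 0 < θ) (b : Bool) {e : ℝ}
    (he : e ∈ Set.Ioo (0 : ℝ) 1) (u : ℝ) : thresholdEstimate θ b e u ^ 2 ≤ (θ ^ 2)⁻¹ := by
  refine (sq_thresholdEstimate_le θ b he u).trans ?_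
  split_ifs with h
  · gcongr
  · positivity

theorem abs_thresholdEstimate_le {θ : ℝ} (hθ : 0 < θ) (b : Bool) {e : ℝ}
    (he : e ∈ Set.Ioo (0 : ℝ) 1) (u : ℝ) : |thresholdEstimate θ b e u| ≤ 1 / θ := by
  refine abs_le_of_sq_le_sq ?_ (by positivity)
  rw [div_pow, one_pow, one_div]
  exact sq_thresholdEstimate_le_of_pos hθ b he u

instance isProbabilityMeasure_volume_restrict_Icc :
    IsProbabilityMeasure (volume.restrict (Set.Icc (0 : ℝ) 1)) :=
  ⟨by simp⟩

theorem integral_thresholdEstimate (θ : ℝ) (b : Bool) {e : ℝ} (he : e ∈ Set.Ioo (0 : ℝ) 1) :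
    ∫ u, thresholdEstimate θ b e u ∂(volume.restrict (Set.Icc (0 : ℝ) 1)) =
      b2r b * if θ ≤ e then 1 else 0 := by
  obtain ⟨he0, he1⟩ := he
  have hden : 1 - 2 * ((1 - e) / 2) = e := by ring
  simp only [thresholdEstimate, b2r_xor_decide, hden]
  rw [integral_mul_const, integral_div]
  congr 1
  have hrw : ∀ u : ℝ, (if u < (1 - e) / 2 then 1 - b2r b else b2r b) - (1 - e) / 2 =
      (Set.Iio ((1 - e) / 2)).indicator (fun _ => 1 - 2 * b2r b) u + (b2r b - (1 - e) / 2) := by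
    intro u
    by_cases hu : u < (1 - e) / 2
    · simp [hu]; ring
    · simp [hu]
  simp_rw [hrw]
  rw [integral_add ((integrable_const _).indicator measurableSet_Iio) (integrable_const _),
    integral_indicator_const _ measurableSet_Iio, integral_const, probReal_univ]
  have hset : Set.Iio ((1 - e) / 2) ∩ Set.Icc (0 : ℝ) 1 = Set.Ico 0 ((1 - e) / 2) := by
    ext u
    simp only [Set.mem_inter_iff, Set.mem_Iio, Set.mem_Icc, Set.mem_Ico]
    constructor
    · rintro ⟨h1, h2, -⟩; exact ⟨h2, h1⟩
    · rintro ⟨h1, h2⟩; exact ⟨h2, h1, by linarith⟩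
  rw [measureReal_restrict_apply measurableSet_Iio, hset, Real.volume_real_Ico_of_le (by linarith)]
  simp only [smul_eq_mul]
  field_simp
  ring

/-- Expected value of the thresholded estimate under random noise parameters. -/
theorem integral_prod_thresholdEstimate {m : Measure ℝ} [IsProbabilityMeasure m] {θ : ℝ}
    (hm : ∀ᵐ e ∂m, e ∈ Set.Ioo (0 : ℝ) 1) (hθ : 0 < θ) (b : Bool) :
    ∫ z, thresholdEstimate θ b z.1 z.2 ∂(m.prod (volume.restrict (Set.Icc (0 : ℝ) 1))) =
      m.real (Set.Ici θ) * b2r b := by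
  have hae : ∀ᵐ z ∂(m.prod (volume.restrict (Set.Icc (0 : ℝ) 1))), z.1 ∈ Set.Ioo (0 : ℝ) 1 :=
    Measure.quasiMeasurePreserving_fst.ae hm
  rw [integral_prod _ (Integrable.of_bound (measurable_thresholdEstimate θ b).aestronglyMeasurable
    (1 / θ) (by filter_upwards [hae] with z hz using abs_thresholdEstimate_le hθ b hz z.2))]
  calc ∫ e, ∫ u, thresholdEstimate θ b e u ∂(volume.restrict (Set.Icc (0 : ℝ) 1)) ∂m
      = ∫ e, b2r b * (Set.Ici θ).indicator (fun _ => (1 : ℝ)) e ∂m := by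
        refine integral_congr_ae ?_
        filter_upwards [hm] with e he
        rw [integral_thresholdEstimate θ b he]
        simp [Set.indicator_apply]
    _ = m.real (Set.Ici θ) * b2r b := by
        rw [integral_const_mul, integral_indicator_const _ measurableSet_Ici, smul_eq_mul, mul_one,
          mul_comm]

theorem integrable_ite_inv_sq {m : Measure ℝ} [IsProbabilityMeasure m] {θ : ℝ} (hθ : 0 < θ) :
    Integrable (fun e => if θ ≤ e then (e ^ 2)⁻¹ else 0) m := by
  refine Integrable.of_bound (Measurable.ite measurableSet_Ici (by fun_prop)
    measurable_const).aestronglyMeasurable ((θ ^ 2)⁻¹) (ae_of_all _ fun e => ?_)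
  split_ifs with h
  · rw [Real.norm_of_nonneg (by positivity)]
    gcongr
  · simp only [norm_zero]; positivity

/-- Second moment of the thresholded estimate under random noise parameters. -/
theorem integral_prod_sq_thresholdEstimate_le {m : Measure ℝ} [IsProbabilityMeasure m] {θ : ℝ}
    (hm : ∀ᵐ e ∂m, e ∈ Set.Ioo (0 : ℝ) 1) (hθ : 0 < θ) (b : Bool) :
    ∫ z, thresholdEstimate θ b z.1 z.2 ^ 2 ∂(m.prod (volume.restrict (Set.Icc (0 : ℝ) 1))) ≤
      ∫ e, (if θ ≤ e then (e ^ 2)⁻¹ else 0) ∂m := by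
  have hae : ∀ᵐ z ∂(m.prod (volume.restrict (Set.Icc (0 : ℝ) 1))), z.1 ∈ Set.Ioo (0 : ℝ) 1 :=
    Measure.quasiMeasurePreserving_fst.ae hm
  have hint := (integrable_ite_inv_sq (m := m) hθ).comp_fst
    (volume.restrict (Set.Icc (0 : ℝ) 1))
  refine (integral_mono_of_nonneg (ae_of_all _ fun z => sq_nonneg _) hint ?_).trans (le_of_eq ?_)
  · filter_upwards [hae] with z hz using sq_thresholdEstimate_le θ b hz z.2
  · rw [integral_prod _ hint]
    simp

theorem measureReal_Ici_le_integral_inv_sq {m : Measure ℝ} [IsProbabilityMeasure m] {θ : ℝ}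
    (hm : ∀ᵐ e ∂m, e ∈ Set.Ioo (0 : ℝ) 1) (hθ : 0 < θ) :
    m.real (Set.Ici θ) ≤ ∫ e, (if θ ≤ e then (e ^ 2)⁻¹ else 0) ∂m := by
  calc m.real (Set.Ici θ) = ∫ e, (Set.Ici θ).indicator (fun _ => (1 : ℝ)) e ∂m := by
        rw [integral_indicator_const _ measurableSet_Ici, smul_eq_mul, mul_one]
    _ ≤ _ := by
        refine integral_mono_ae ((integrable_const _).indicator measurableSet_Ici)
          (integrable_ite_inv_sq hθ) ?_
        filter_upwards [hm] with e he
        simp only [Set.indicator_apply, Set.mem_Ici]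
        split_ifs
        · exact (one_le_inv₀ (pow_pos he.1 2)).2 (pow_le_one₀ he.1.le he.2.le)
        · exact le_rfl

theorem integral_ite_inv_sq_le {m : Measure ℝ} [IsProbabilityMeasure m] {θ : ℝ} (hθ : 0 < θ) :
    ∫ e, (if θ ≤ e then (e ^ 2)⁻¹ else 0) ∂m ≤ (θ ^ 2)⁻¹ := by
  refine (integral_mono (integrable_ite_inv_sq hθ) (integrable_const ((θ ^ 2)⁻¹)) fun e => ?_).trans
    (by simp)
  simp only
  split_ifs with h
  · gcongr
  · positivity

/-- Expected regret of exponential weights run on thresholded loss estimates, for a fixed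
comparator. -/
theorem expWeights_thresholdEstimate_regret_le {K T : ℕ} {D : Measure (Fin K → ℝ)}
    [IsProbabilityMeasure D] {m : Measure ℝ} [IsProbabilityMeasure m]
    (hD : ∀ i : Fin K, D.map (fun v => v i) = m) (hm : ∀ᵐ e ∂m, e ∈ Set.Ioo (0 : ℝ) 1)
    {θ η : ℝ} (hθ : 0 < θ) (hη : 0 < η) (hηθ : η ≤ θ) (ℓ : Fin K → Fin T → Bool)
    {w : ((Fin T → Fin K → ℝ) × (Fin T → Fin K → ℝ)) → Fin K → ℕ → ℝ}
    (h0 : ∀ ω i, w ω i 0 = 1)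
    (hs : ∀ ω i (t : Fin T), w ω i ((t : ℕ) + 1) =
      w ω i t * Real.exp (-η * thresholdEstimate θ (ℓ i t) (ω.1 t i) (ω.2 t i))) (k : Fin K) :
    η * (m.real (Set.Ici θ) * ((∫ ω, (∑ t : Fin T, ∑ i, w ω i t / (∑ j, w ω j t) * b2r (ℓ i t))
            ∂((Measure.pi fun _ : Fin T => D).prod
                (Measure.pi fun _ : Fin T => Measure.pi fun _ : Fin K =>
                  volume.restrict (Set.Icc 0 1)))) - ∑ t, b2r (ℓ k t))) ≤
      Real.log K + η ^ 2 * (T * ∫ e, (if θ ≤ e then (e ^ 2)⁻¹ else 0) ∂m) := by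
  set U : Measure ℝ := volume.restrict (Set.Icc (0 : ℝ) 1) with hU
  set P : Measure ((Fin T → Fin K → ℝ) × (Fin T → Fin K → ℝ)) :=
    (Measure.pi fun _ : Fin T => D).prod (Measure.pi fun _ : Fin T => Measure.pi fun _ : Fin K => U)
    with hP
  have hcoord : ∀ i t, MeasurePreserving
      (fun ω : (Fin T → Fin K → ℝ) × (Fin T → Fin K → ℝ) => (ω.1 t i, ω.2 t i))
      P (m.prod U) := fun i t =>
    MeasurePreserving.prod
      (MeasurePreserving.comp ⟨measurable_pi_apply i, hD i⟩
        (measurePreserving_eval (fun _ : Fin T => D) t))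
      ((measurePreserving_eval (fun _ : Fin K => U) i).comp
        (measurePreserving_eval (fun _ : Fin T => Measure.pi fun _ : Fin K => U) t))
  have hlaw : ∀ i t {f : ℝ × ℝ → ℝ}, Measurable f →
      ∫ ω, f (ω.1 t i, ω.2 t i) ∂P = ∫ z, f z ∂(m.prod U) := fun i t f hf => by
    rw [← (hcoord i t).map_eq, integral_map (hcoord i t).measurable.aemeasurable
      hf.aestronglyMeasurable]
  have hae : ∀ᵐ ω ∂P, ∀ i t, ω.1 t i ∈ Set.Ioo (0 : ℝ) 1 := by
    rw [ae_all_iff]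
    intro i
    rw [ae_all_iff]
    intro t
    exact (hcoord i t).quasiMeasurePreserving.ae (Measure.quasiMeasurePreserving_fst.ae hm)
  have hmeas : ∀ i t, Measurable fun ω : (Fin T → Fin K → ℝ) × (Fin T → Fin K → ℝ) =>
      thresholdEstimate θ (ℓ i t) (ω.1 t i) (ω.2 t i) := fun i t => by
    apply (measurable_thresholdEstimate θ (ℓ i t)).comp (hcoord i t).measurable
  have hindep : ProbabilityTheory.iIndepFun
      (fun t ω i => thresholdEstimate θ (ℓ i t) (ω.1 t i) (ω.2 t i)) P :=
    (iIndepFun_prodMk_eval (ι := Fin T) D (Measure.pi fun _ : Fin K => U)).comp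
      (fun t z i => thresholdEstimate θ (ℓ i t) (z.1 i) (z.2 i))
      fun t => measurable_pi_lambda _ fun i =>
        (measurable_thresholdEstimate θ (ℓ i t)).comp
          (f := fun z : (Fin K → ℝ) × (Fin K → ℝ) => (z.1 i, z.2 i)) (by fun_prop)
  have hbound : ∀ᵐ ω ∂P, ∀ i t,
      |η * thresholdEstimate θ (ℓ i t) (ω.1 t i) (ω.2 t i)| ≤ 1 := by
    filter_upwards [hae] with ω hω i t
    rw [abs_mul, abs_of_pos hη]
    calc η * |thresholdEstimate θ (ℓ i t) (ω.1 t i) (ω.2 t i)| ≤ θ * (1 / θ) :=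
          mul_le_mul hηθ (abs_thresholdEstimate_le hθ _ (hω i t) _) (abs_nonneg _) hθ.le
      _ = 1 := by field_simp
  have hmean : ∀ i t, ∫ ω, thresholdEstimate θ (ℓ i t) (ω.1 t i) (ω.2 t i) ∂P =
      m.real (Set.Ici θ) * b2r (ℓ i t) := fun i t => by
    rw [hlaw i t (measurable_thresholdEstimate θ (ℓ i t)), integral_prod_thresholdEstimate hm hθ]
  have hvar : ∀ i t, ∫ ω, thresholdEstimate θ (ℓ i t) (ω.1 t i) (ω.2 t i) ^ 2 ∂P ≤
      ∫ e, (if θ ≤ e then (e ^ 2)⁻¹ else 0) ∂m := fun i t => by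
    rw [hlaw i t ((measurable_thresholdEstimate θ (ℓ i t)).pow_const 2)]
    exact integral_prod_sq_thresholdEstimate_le hm hθ (ℓ i t)
  have := expWeights_expected_regret_le (b := fun i t => b2r (ℓ i t)) hη hmeas hindep hbound hmean
    hvar h0 hs k
  rwa [Fintype.card_fin] at this

/-- The average loss under exponential weights is at most the number of rounds. -/
theorem integral_expWeights_le {Ω ι : Type*} [MeasurableSpace Ω] [Fintype ι] {T : ℕ}
    {μ : Measure Ω} [IsProbabilityMeasure μ] {x : Ω → ι → Fin T → ℝ} {w : Ω → ι → ℕ → ℝ}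
    {b : ι → Fin T → ℝ} {η : ℝ} (hb0 : ∀ i t, 0 ≤ b i t) (hb1 : ∀ i t, b i t ≤ 1)
    (h0 : ∀ ω i, w ω i 0 = 1)
    (hs : ∀ ω i (t : Fin T), w ω i ((t : ℕ) + 1) = w ω i t * Real.exp (-η * x ω i t)) :
    ∫ ω, (∑ t : Fin T, ∑ i, w ω i t / (∑ j, w ω j t) * b i t) ∂μ ≤ T := by
  have hq : ∀ ω i (t : Fin T), 0 ≤ w ω i t / ∑ j, w ω j t := fun ω i t => by
    have hpos : ∀ j, 0 ≤ w ω j t := fun j => by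
      rw [expWeights_eq_exp_sum (h0 ω) (hs ω) j t.2.le]; exact (Real.exp_pos _).le
    exact div_nonneg (hpos i) (Finset.sum_nonneg fun j _ => hpos j)
  have hround : ∀ ω (t : Fin T), ∑ i, w ω i t / (∑ j, w ω j t) * b i t ≤ 1 := fun ω t =>
    calc ∑ i, w ω i t / (∑ j, w ω j t) * b i t ≤ ∑ i, w ω i t / ∑ j, w ω j t :=
          Finset.sum_le_sum fun i _ => mul_le_of_le_one_right (hq ω i t) (hb1 i t)
      _ ≤ 1 := by rw [← Finset.sum_div]; exact div_self_le_one _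
  have hle : ∀ ω, ‖∑ t : Fin T, ∑ i, w ω i t / (∑ j, w ω j t) * b i t‖ ≤ T := fun ω => by
    rw [Real.norm_of_nonneg (Finset.sum_nonneg fun t _ => Finset.sum_nonneg fun i _ =>
      mul_nonneg (hq ω i t) (hb0 i t))]
    exact (Finset.sum_le_sum fun t _ => hround ω t).trans (by simp)
  have := norm_integral_le_of_norm_le_const (μ := μ) (ae_of_all _ hle)
  rw [probReal_univ, mul_one] at this
  exact (le_abs_self _).trans this

/-- Tuning of the learning rate: `R` stands for the regret, `G` for the probability that a noise
parameter passes the threshold and `V` for the second moment of the estimates. -/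
theorem regret_le_of_tuned_rate {L T θ η G V R r : ℝ} (hL : 0 < L) (hT : 0 < T) (hθ : 0 < θ)
    (hr : 0 < r) (hrL : L = T * r ^ 2) (hG : 1 / 2 ≤ G) (hV : 0 < V) (hVθ : V ≤ (θ ^ 2)⁻¹)
    (hη : η = Real.sqrt (L / (T * V))) (hR : η * (G * R) ≤ L + η ^ 2 * (T * V)) :
    R ≤ 4 * (T * (r / θ)) := by
  have hsq : η ^ 2 = L / (T * V) := by rw [hη, Real.sq_sqrt (by positivity)]
  have hηr : θ * r ≤ η := by
    rw [hη]
    refine Real.le_sqrt_of_sq_le ?_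
    rw [le_div_iff₀ (by positivity), hrL]
    have : θ ^ 2 * V ≤ 1 := by
      calc θ ^ 2 * V ≤ θ ^ 2 * (θ ^ 2)⁻¹ := by gcongr
        _ = 1 := mul_inv_cancel₀ (by positivity)
    calc (θ * r) ^ 2 * (T * V) = (T * r ^ 2) * (θ ^ 2 * V) := by ring
      _ ≤ (T * r ^ 2) * 1 := by gcongr
      _ = T * r ^ 2 := mul_one _
  have hη0 : 0 ≤ η := by rw [hη]; positivity
  have hRL : η * (G * R) ≤ 2 * L := by
    refine hR.trans (le_of_eq ?_)
    rw [hsq]; field_simp; ring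
  rcases le_or_gt R 0 with hR0 | hR0
  · exact hR0.trans (by positivity)
  · have h1 : θ * r * (1 / 2 * R) ≤ 2 * L := le_trans (by gcongr) hRL
    rw [mul_div_assoc', mul_div_assoc', le_div_iff₀ hθ]
    rw [hrL] at h1
    refine le_of_mul_le_mul_left (a := r) ?_ hr
    linarith

/-- EW-Threshold under a marginal CDF satisfying `F(θ) ≤ θ^α`, with the
parameter choices of Corollary 13; the constant `C` depends only on `α`. -/
theorem ew_threshold_polynomial_cdf (α : ℝ) (hα : 0 < α) :
    ∃ C : ℝ, 0 < C ∧
      ∀ (K T : ℕ) (hK : 2 ≤ K) (hT : 1 ≤ T)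
        (D : Measure (Fin K → ℝ)), IsProbabilityMeasure D →
      ∀ (m : Measure ℝ), (∀ i : Fin K, D.map (fun v => v i) = m) →
        m (Set.Ioo (0 : ℝ) 1)ᶜ = 0 →
      ∀ (F g : ℝ → ℝ),
        (∀ x, F x = (m (Set.Iic x)).toReal) →
        (∀ x, g x = ∫ e, (if x ≤ e then (e ^ 2)⁻¹ else 0) ∂m) →
        (∀ x ∈ Set.Ioo (0 : ℝ) 1, F x ≤ x ^ α) →
      ∀ (θ η : ℝ),
        θ = (2 / α) ^ (1 / (1 + α)) * (Real.log K / T) ^ (1 / (2 * (1 + α))) →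
        η = Real.sqrt (Real.log K / (T * g θ)) →
        θ ≤ 1 →
      ∀ (ℓ : Fin K → Fin T → Bool)
        (c : Fin K → Fin T → ((Fin T → Fin K → ℝ) × (Fin T → Fin K → ℝ)) → Bool),
        (∀ i t ω, c i t ω = Bool.xor (ℓ i t) (decide (ω.2 t i < (1 - ω.1 t i) / 2))) →
      ∀ lhat : ((Fin T → Fin K → ℝ) × (Fin T → Fin K → ℝ)) → Fin K → Fin T → ℝ,
        (∀ ω i t, lhat ω i t =
          (b2r (c i t ω) - (1 - ω.1 t i) / 2) / (1 - 2 * ((1 - ω.1 t i) / 2)) *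
            (if θ ≤ ω.1 t i then 1 else 0)) →
      ∀ (w : ((Fin T → Fin K → ℝ) × (Fin T → Fin K → ℝ)) → Fin K → ℕ → ℝ)
        (q : ((Fin T → Fin K → ℝ) × (Fin T → Fin K → ℝ)) → Fin K → Fin T → ℝ),
        (∀ ω i, w ω i 0 = 1) →
        (∀ ω i (t : Fin T), w ω i ((t : ℕ) + 1) = w ω i t * Real.exp (-η * lhat ω i t)) →
        (∀ ω i t, q ω i t = w ω i t / ∑ j, w ω j t) →
        (∫ ω, (∑ t, ∑ i, q ω i t * b2r (ℓ i t))
            ∂((Measure.pi fun _ : Fin T => D).prod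
                (Measure.pi fun _ : Fin T => Measure.pi fun _ : Fin K =>
                  volume.restrict (Set.Icc 0 1))))
          - Finset.univ.inf' (Finset.univ_nonempty_iff.mpr ⟨⟨0, by omega⟩⟩)
              (fun k => ∑ t, b2r (ℓ k t))
          ≤ C * (T : ℝ) ^ ((2 + α) / (2 + 2 * α)) * Real.log K ^ (α / (2 * (1 + α))) := by
  refine ⟨(2 + 2 * α) * (2 / α) ^ (α / (1 + α)), by positivity, ?_⟩
  intro K T hK hT D hDprob m hD hm F g hF hg hFα θ η hθ hη hθ1 ℓ c hc lhat hlhat w q h0 hs hq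
  have hα1 : 0 < 1 + α := by linarith
  have hTpos : (0 : ℝ) < T := by exact_mod_cast hT
  have hL : 0 < Real.log K := Real.log_pos (by exact_mod_cast hK)
  have hLT : 0 < Real.log K / T := div_pos hL hTpos
  have hθ0 : 0 < θ := by rw [hθ]; positivity
  have hmprob : IsProbabilityMeasure m := by
    rw [← hD ⟨0, by omega⟩]
    exact Measure.isProbabilityMeasure_map (measurable_pi_apply _).aemeasurable
  have hmae : ∀ᵐ e ∂m, e ∈ Set.Ioo (0 : ℝ) 1 := by rwa [ae_iff]
  have hs' : ∀ ω i (t : Fin T), w ω i ((t : ℕ) + 1) =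
      w ω i t * Real.exp (-η * thresholdEstimate θ (ℓ i t) (ω.1 t i) (ω.2 t i)) := by
    intro ω i t
    rw [hs, hlhat, hc, thresholdEstimate]
  simp_rw [hq]
  have hrhs : (2 + 2 * α) * (2 / α) ^ (α / (1 + α)) * (T : ℝ) ^ ((2 + α) / (2 + 2 * α)) *
      Real.log K ^ (α / (2 * (1 + α))) = (2 + 2 * α) * (T * θ ^ α) := by
    rw [hθ, Real.mul_rpow (by positivity) (by positivity), ← Real.rpow_mul (by positivity),
      ← Real.rpow_mul hLT.le, Real.div_rpow hL.le hTpos.le]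
    have h1 : 1 / (1 + α) * α = α / (1 + α) := by ring
    have h2 : 1 / (2 * (1 + α)) * α = α / (2 * (1 + α)) := by ring
    have h3 : (T : ℝ) ^ ((2 + α) / (2 + 2 * α)) = T / (T : ℝ) ^ (α / (2 * (1 + α))) := by
      rw [eq_div_iff (by positivity), ← Real.rpow_add hTpos]
      have : (2 + α) / (2 + 2 * α) + α / (2 * (1 + α)) = 1 := by field_simp; ring
      rw [this, Real.rpow_one]
    rw [h1, h2, h3]
    ring
  rw [hrhs]
  obtain ⟨k, -, hk⟩ := Finset.exists_mem_eq_inf' (Finset.univ_nonempty_iff.mpr ⟨⟨0, by omega⟩⟩)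
    (fun k : Fin K => ∑ t, b2r (ℓ k t))
  rw [hk]
  rcases lt_or_ge 1 ((2 + α) * θ ^ α) with hbig | hsmall
  · have h1 := integral_expWeights_le (μ := (Measure.pi fun _ : Fin T => D).prod
      (Measure.pi fun _ : Fin T => Measure.pi fun _ : Fin K => volume.restrict (Set.Icc 0 1)))
      (fun i t => b2r_nonneg (ℓ i t)) (fun i t => b2r_le_one (ℓ i t)) h0 hs'
    have h2 : 0 ≤ ∑ t, b2r (ℓ k t) := Finset.sum_nonneg fun t _ => b2r_nonneg _
    have h3 : 0 < T * θ ^ α := by positivity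
    have h4 := mul_lt_mul_of_pos_left hbig hTpos
    have h5 := mul_pos hα h3
    linarith
  · have hθα : 0 < θ ^ α := by positivity
    have hθlt : θ < 1 := by
      refine lt_of_le_of_ne hθ1 fun h => ?_
      rw [h, Real.one_rpow] at hsmall
      linarith
    have hG : 1 / 2 ≤ m.real (Set.Ici θ) := by
      have h1 : m.real (Set.Iic θ) ≤ θ ^ α := by
        have := hFα θ ⟨hθ0, hθlt⟩
        rwa [hF] at this
      have h2 : 1 ≤ m.real (Set.Iic θ) + m.real (Set.Ici θ) := by
        rw [← probReal_univ (μ := m), ← Set.Iic_union_Ici (a := θ)]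
        exact measureReal_union_le _ _
      have h3 := mul_pos hα hθα
      linarith
    have hVG := measureReal_Ici_le_integral_inv_sq hmae hθ0
    have hVθ := integral_ite_inv_sq_le (m := m) hθ0
    rw [hg] at hη
    set V := ∫ e, (if θ ≤ e then (e ^ 2)⁻¹ else 0) ∂m
    have hV : 1 / 2 ≤ V := hG.trans hVG
    have hV0 : 0 < V := by linarith
    set r := α / 2 * θ ^ (1 + α) with hr
    have hr0 : 0 < r := by positivity
    have hrL : Real.log K = T * r ^ 2 := by
      have h1 : θ ^ (1 + α) = 2 / α * (Real.log K / T) ^ (1 / 2 : ℝ) := by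
        rw [hθ, Real.mul_rpow (by positivity) (by positivity), ← Real.rpow_mul (by positivity),
          ← Real.rpow_mul hLT.le]
        have e1 : 1 / (1 + α) * (1 + α) = 1 := by field_simp
        have e2 : 1 / (2 * (1 + α)) * (1 + α) = 1 / 2 := by field_simp
        rw [e1, e2, Real.rpow_one]
      rw [hr, h1, ← Real.sqrt_eq_rpow]
      have h2 : α / 2 * (2 / α * Real.sqrt (Real.log K / T)) = Real.sqrt (Real.log K / T) := by
        field_simp
      rw [h2, Real.sq_sqrt hLT.le]
      field_simp
    have hrθ : r / θ = α / 2 * θ ^ α := by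
      rw [hr, Real.rpow_add hθ0, Real.rpow_one]
      field_simp
    have hη0 : 0 < η := by rw [hη]; positivity
    have hηθ : η ≤ θ := by
      rw [hη]
      refine Real.sqrt_le_iff.2 ⟨hθ0.le, ?_⟩
      have hrle : 2 * r ≤ θ := by
        rw [div_eq_iff hθ0.ne'] at hrθ
        rw [hrθ]
        have : α * θ ^ α ≤ 1 := by linarith
        nlinarith
      rw [div_le_iff₀ (by positivity), hrL]
      calc (T : ℝ) * r ^ 2 ≤ T * ((2 * r) ^ 2 * V) := by
            gcongr
            nlinarith [sq_nonneg r]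
        _ ≤ T * (θ ^ 2 * V) := by gcongr
        _ = θ ^ 2 * (T * V) := by ring
    have hR := expWeights_thresholdEstimate_regret_le hD hmae hθ0 hη0 hηθ ℓ h0 hs' k
    have hfinal := regret_le_of_tuned_rate hL hTpos hθ0 hr0 hrL hG hV0 hVθ hη hR
    rw [hrθ] at hfinal
    have h3 : 0 < T * θ ^ α := by positivity
    linarith
end
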